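/- arXiv:2109.08579 — 2 statements merged into one kernel-verified Lean document; each statement's English description precedes it below -/
import Mathlib

section
/- Let r, s, λ > 0. Let G₁ ∼ Γ(r,λ) and G₂ ∼ Γ(s,λ) (densities λ^r x^{r−1}e^{−λx}/Γ(r) and λ^s x^{s−1}e^{−λx}/Γ(s) on (0,∞)) be independent, and set Y = G₁G₂. Define the operator S f(y) = y² f''(y) + (1+r+s) y f'(y) + (rs − λ² y) f(y). Let W be a real-valued random variable with E[W²] < ∞. Then W is equal in law to G₁G₂ if and only if E[S f(W)] = 0 for all f ∈ F_{S,Y}. -/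
open MeasureTheory ProbabilityTheory Filter Set
open scoped Topology

/-- The gamma distribution `Γ(r, l)`, with density `l^r x^(r-1) e^(-l x) / Γ(r)` on
`(0, ∞)`. -/
noncomputable def gammaDist (r l : ℝ) : Measure ℝ :=
  volume.withDensity fun x =>
    ENNReal.ofReal (Set.indicator (Set.Ioi (0 : ℝ))
      (fun x => l ^ r * x ^ (r - 1) * Real.exp (-l * x) / Real.Gamma r) x)

/-- The Stein operator
`S f y = y² f''(y) + (1+r+s) y f'(y) + (rs - l² y) f(y)` for the product of independent
`Γ(r,l)` and `Γ(s,l)` random variables, acting on functions on `I = (0, ∞)`. -/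
noncomputable def steinGammaGamma (r s l : ℝ) (f : ℝ → ℝ) (y : ℝ) : ℝ :=
  y ^ 2 * iteratedDerivWithin 2 f (Set.Ioi 0) y
    + (1 + r + s) * y * derivWithin f (Set.Ioi 0) y
    + (r * s - l ^ 2 * y) * f y

/-- Membership in the class `F_{S,Y}` (here `T = 2`, `m = 2`, `I = (0, ∞)`). -/
def memFGG {Ω : Type*} [MeasurableSpace Ω] (μ : Measure Ω) (Y : Ω → ℝ)
    (f : ℝ → ℝ) : Prop :=
  ContDiffOn ℝ 2 f (Set.Ioi 0) ∧
    ∀ t ≤ 2, ∀ j ≤ 2,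
      Integrable (fun ω => (Y ω) ^ j * iteratedDerivWithin t f (Set.Ioi 0) (Y ω)) μ


lemma gg_nonneg_of_deriv (g g' : ℝ → ℝ) (hd : ∀ t > 0, HasDerivAt g (g' t) t)
    (hg : ∀ t > 0, 0 ≤ g' t) (hlim : Tendsto g (𝓝[>] 0) (𝓝 0)) : ∀ t > 0, 0 ≤ g t := by
  have hm : MonotoneOn g (Ioi 0) := by
    apply monotoneOn_of_deriv_nonneg (convex_Ioi 0)
    · exact fun t ht => (hd t ht).continuousAt.continuousWithinAt
    · rw [interior_Ioi]
      exact fun t ht => (hd t ht).differentiableAt.differentiableWithinAt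
    · rw [interior_Ioi]
      intro t ht
      rw [(hd t ht).deriv]
      exact hg t ht
  intro t ht
  refine le_of_tendsto hlim ?_
  filter_upwards [Ioo_mem_nhdsGT ht] with u hu
  exact hm hu.1 ht hu.2.le

lemma gg_abs_le_of_deriv (g g' H H' : ℝ → ℝ) (hd : ∀ t > 0, HasDerivAt g (g' t) t)
    (hH : ∀ t > 0, HasDerivAt H (H' t) t) (hle : ∀ t > 0, |g' t| ≤ H' t)
    (hlim : Tendsto g (𝓝[>] 0) (𝓝 0)) (hlimH : Tendsto H (𝓝[>] 0) (𝓝 0)) :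
    ∀ t > 0, |g t| ≤ H t := by
  intro t ht
  have h1 := gg_nonneg_of_deriv (fun t => H t - g t) (fun t => H' t - g' t)
    (fun t ht => (hH t ht).sub (hd t ht))
    (fun t ht => by linarith [(abs_le.1 (hle t ht)).2]) (by simpa using hlimH.sub hlim) t ht
  have h2 := gg_nonneg_of_deriv (fun t => H t + g t) (fun t => H' t + g' t)
    (fun t ht => (hH t ht).add (hd t ht))
    (fun t ht => by linarith [(abs_le.1 (hle t ht)).1]) (by simpa using hlimH.add hlim) t ht
  rw [abs_le]
  constructor <;> linarith

lemma gg_ode_unique (D D1 D2 : ℝ → ℝ) (a k q M : ℝ) (ha : 0 < a) (hk : 0 < k) (hq : 0 ≤ q)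
    (hD : ∀ t > 0, HasDerivAt D (D1 t) t) (hD1 : ∀ t > 0, HasDerivAt D1 (D2 t) t)
    (hode : ∀ t > 0, t ^ 2 * D2 t + (a * t + k) * D1 t + q * D t = 0)
    (hM : ∀ t > 0, |D t| ≤ M) (hM1 : ∀ t > 0, |D1 t| ≤ M)
    (hlim : Tendsto D (𝓝[>] 0) (𝓝 0)) : ∀ t > 0, D t = 0 := by
  have hM0 : 0 ≤ M := (abs_nonneg _).trans (hM 1 one_pos)
  set p : ℝ → ℝ := fun t => t ^ a * Real.exp (-k / t) with hp
  have hp0 : ∀ t > 0, 0 < p t := fun t ht => by positivity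
  have hpd : ∀ t > 0, HasDerivAt p (p t * (a / t + k / t ^ 2)) t := by
    intro t ht
    have h1 := Real.hasDerivAt_rpow_const (x := t) (p := a) (Or.inl ht.ne')
    have h2 : HasDerivAt (fun t : ℝ => -k / t) (k / t ^ 2) t := by
      have := (hasDerivAt_inv ht.ne').const_mul (-k)
      refine this.congr_deriv ?_
      field_simp
    refine (h1.mul h2.exp).congr_deriv ?_
    rw [Real.rpow_sub_one ht.ne']
    simp only [hp]
    field_simp
  have hple : ∀ t > 0, p t ≤ t ^ a := by
    intro t ht
    have : Real.exp (-k / t) ≤ 1 := by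
      rw [Real.exp_le_one_iff, neg_div]
      have : 0 < k / t := by positivity
      linarith
    calc p t ≤ t ^ a * 1 := by simp only [hp]; gcongr
      _ = t ^ a := mul_one _
  have hta : Tendsto (fun t : ℝ => t ^ a) (𝓝[>] 0) (𝓝 0) := by
    have := (Real.continuous_rpow_const ha.le).tendsto (0 : ℝ)
    rw [Real.zero_rpow ha.ne'] at this
    exact this.mono_left nhdsWithin_le_nhds
  have hplim : Tendsto p (𝓝[>] 0) (𝓝 0) := by
    refine tendsto_of_tendsto_of_tendsto_of_le_of_le' tendsto_const_nhds hta ?_ ?_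
    · filter_upwards [self_mem_nhdsWithin] with t ht using (hp0 t ht).le
    · filter_upwards [self_mem_nhdsWithin] with t ht using hple t ht
  set C := q / k with hC
  have hC0 : 0 ≤ C := by positivity
  have key : ∀ n : ℕ, ∀ t > 0, |D t| ≤ M * (C * t) ^ n / n.factorial := by
    intro n
    induction n with
    | zero => intro t ht; simpa using hM t ht
    | succ n ih =>
      have hfac : (0 : ℝ) < n.factorial := by positivity
      have step1 : ∀ t > 0, |p t * D1 t| ≤ (C * M * C ^ n / n.factorial) * t ^ n * p t := by
        apply gg_abs_le_of_deriv (fun t => p t * D1 t)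
          (fun t => - (q * p t / t ^ 2 * D t)) (fun t => (C * M * C ^ n / n.factorial) * t ^ n * p t)
          (fun t => (C * M * C ^ n / n.factorial) * (n * t ^ (n - 1)) * p t
            + (C * M * C ^ n / n.factorial) * t ^ n * (p t * (a / t + k / t ^ 2)))
        · intro t ht
          refine ((hpd t ht).mul (hD1 t ht)).congr_deriv ?_
          have := hode t ht
          have e : D2 t = - ((a * t + k) * D1 t + q * D t) / t ^ 2 := by
            field_simp; linarith
          rw [e]; field_simp; ring
        · intro t ht
          exact ((hasDerivAt_pow n t).const_mul _).mul (hpd t ht)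
        · intro t ht
          have hpt := hp0 t ht
          have h1 : |-(q * p t / t ^ 2 * D t)| ≤ q * p t / t ^ 2 * (M * (C * t) ^ n / n.factorial) := by
            rw [abs_neg, abs_mul, abs_of_nonneg (by positivity)]
            gcongr
            exact ih t ht
          have h2 : q * p t / t ^ 2 * (M * (C * t) ^ n / n.factorial)
              = (C * M * C ^ n / n.factorial) * t ^ n * (p t * (k / t ^ 2)) := by
            have : q = C * k := by simp only [hC]; field_simp
            rw [this, mul_pow]; field_simp
          have h3 : 0 ≤ (C * M * C ^ n / n.factorial) * (n * t ^ (n - 1)) * p t := by positivity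
          have h4 : 0 ≤ (C * M * C ^ n / n.factorial) * t ^ n * (p t * (a / t)) := by positivity
          nlinarith
        · refine squeeze_zero_norm' (a := fun t => M * p t) ?_ (by simpa using hplim.const_mul M)
          filter_upwards [self_mem_nhdsWithin] with t ht
          have hpt := hp0 t ht
          rw [Real.norm_eq_abs, abs_mul, abs_of_pos hpt, mul_comm]
          gcongr
          exact hM1 t ht
        · have h1 : Tendsto (fun t : ℝ => (C * M * C ^ n / n.factorial) * t ^ n) (𝓝[>] 0)
              (𝓝 ((C * M * C ^ n / n.factorial) * 0 ^ n)) := by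
            refine Tendsto.mono_left ?_ nhdsWithin_le_nhds
            exact Continuous.tendsto (by fun_prop) 0
          simpa using h1.mul hplim
      have step2 : ∀ t > 0, |D1 t| ≤ (C * M * C ^ n / n.factorial) * t ^ n := by
        intro t ht
        have h := step1 t ht
        have hpt := hp0 t ht
        rw [abs_mul, abs_of_pos hpt, mul_comm] at h
        exact le_of_mul_le_mul_right h hpt
      intro t ht
      have := gg_abs_le_of_deriv D D1 (fun t => M * (C * t) ^ (n+1) / (n+1).factorial)
        (fun t => (C * M * C ^ n / n.factorial) * t ^ n) hD ?_ step2 hlim ?_ t ht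
      · exact this
      · intro t ht
        have h1 := (((hasDerivAt_id t).const_mul C).pow (n+1)).const_mul (M / (n+1).factorial)
        have h2 : HasDerivAt (fun t => M * (C * t) ^ (n+1) / (n+1).factorial) _ t :=
          h1.congr_of_eventuallyEq (Eventually.of_forall fun t => by simp; ring)
        refine h2.congr_deriv ?_
        rw [Nat.factorial_succ]
        push_cast
        simp only [id, mul_pow]
        field_simp
      · have : Tendsto (fun t : ℝ => M * (C * t) ^ (n+1) / (n+1).factorial) (𝓝[>] 0)
            (𝓝 (M * (C * 0) ^ (n+1) / (n+1).factorial)) :=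
          Tendsto.mono_left (Continuous.tendsto (by fun_prop) 0) nhdsWithin_le_nhds
        simpa using this
  intro t ht
  have h0 : Tendsto (fun n : ℕ => M * (C * t) ^ n / n.factorial) atTop (𝓝 0) := by
    have := (FloorSemiring.tendsto_pow_div_factorial_atTop (C * t)).const_mul M
    simpa [mul_div_assoc] using this
  have := ge_of_tendsto' h0 (fun n => key n t ht)
  exact abs_eq_zero.1 (le_antisymm this (abs_nonneg _))

lemma gg_laplace_ext (ρ σ : Measure ℝ) [IsProbabilityMeasure ρ] [IsProbabilityMeasure σ]
    (hρ : ∀ᵐ x ∂ρ, 0 < x) (hσ : ∀ᵐ x ∂σ, 0 < x)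
    (h : ∀ t > 0, ∫ x, Real.exp (-t * x) ∂ρ = ∫ x, Real.exp (-t * x) ∂σ) : ρ = σ := by
  have hn : ∀ n : ℕ, ∫ x, Real.exp (-(n:ℝ) * x) ∂ρ = ∫ x, Real.exp (-(n:ℝ) * x) ∂σ := by
    intro n
    rcases Nat.eq_zero_or_pos n with rfl | hn
    · simp
    · exact h n (by exact_mod_cast hn)
  have hser : ∀ (τ : Measure ℝ) [IsProbabilityMeasure τ] (hτ : ∀ᵐ x ∂τ, 0 < x) (z : ℂ),
      complexMGF (fun x => Real.exp (-x)) τ z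
        = ∑' n : ℕ, (z ^ n / n.factorial) * ((∫ x, Real.exp (-(n:ℝ) * x) ∂τ : ℝ) : ℂ) := by
    intro τ _ hτ z
    have hpow : ∀ (n : ℕ) (x : ℝ), Real.exp (-(n:ℝ) * x) = Real.exp (-x) ^ n := by
      intro n x
      rw [← Real.exp_nat_mul]; ring_nf
    have hb : ∀ n : ℕ, ∀ᵐ x ∂τ,
        ‖(z ^ n / n.factorial) * ((Real.exp (-(n:ℝ) * x) : ℝ) : ℂ)‖ ≤ ‖z‖ ^ n / n.factorial := by
      intro n
      filter_upwards [hτ] with x hx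
      have h1 : Real.exp (-(n:ℝ) * x) ≤ 1 := by
        rw [Real.exp_le_one_iff]
        have : 0 ≤ (n:ℝ) * x := by positivity
        linarith
      rw [norm_mul, norm_div, norm_pow, Complex.norm_natCast, Complex.norm_real,
        Real.norm_eq_abs, abs_of_pos (Real.exp_pos _)]
      exact mul_le_of_le_one_right (by positivity) h1
    have hint : ∀ n : ℕ, Integrable
        (fun x => (z ^ n / n.factorial) * ((Real.exp (-(n:ℝ) * x) : ℝ) : ℂ)) τ := by
      intro n
      refine Integrable.of_bound (C := ‖z‖ ^ n / n.factorial) ?_ (hb n)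
      exact Continuous.aestronglyMeasurable (by fun_prop)
    have hsum : Summable fun n : ℕ => ∫ x,
        ‖(z ^ n / n.factorial) * ((Real.exp (-(n:ℝ) * x) : ℝ) : ℂ)‖ ∂τ := by
      refine Summable.of_nonneg_of_le (fun n => integral_nonneg fun _ => norm_nonneg _) (fun n => ?_)
        (Real.summable_pow_div_factorial ‖z‖)
      refine (integral_mono_ae (hint n).norm (integrable_const _) (hb n)).trans ?_
      simp
    have := (hasSum_integral_of_summable_integral_norm hint hsum).tsum_eq
    rw [complexMGF]
    refine Eq.trans ?_ (this.symm.trans ?_)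
    · refine integral_congr_ae (Eventually.of_forall fun x => ?_)
      simp only
      have h2 : (Complex.exp (z * ((Real.exp (-x) : ℝ) : ℂ))) = _ :=
        congrFun Complex.exp_eq_exp_ℂ _
      rw [h2, NormedSpace.exp_eq_tsum_div]
      refine tsum_congr fun n => ?_
      rw [hpow, mul_pow]
      push_cast
      ring
    · refine tsum_congr fun n => ?_
      rw [integral_const_mul, integral_complex_ofReal]
  have hm : ρ.map (fun x => Real.exp (-x)) = σ.map (fun x => Real.exp (-x)) := by
    apply Measure.ext_of_complexMGF_eq (by fun_prop) (by fun_prop)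
    ext z
    rw [hser ρ hρ, hser σ hσ]
    simp_rw [hn]
  have hm2 := congrArg (fun m => Measure.map (fun y => - Real.log y) m) hm
  rw [Measure.map_map (by fun_prop) (by fun_prop), Measure.map_map (by fun_prop) (by fun_prop)] at hm2
  have : ((fun y => - Real.log y) ∘ fun x => Real.exp (-x)) = id := by
    ext x; simp
  rw [this] at hm2
  simpa using hm2

lemma gg_laplace_facts (ρ : Measure ℝ) [IsProbabilityMeasure ρ]
    (hρ : ∀ᵐ x ∂ρ, 0 < x) (hint : Integrable (fun x : ℝ => x) ρ) :
    (∀ t > 0, HasDerivAt (fun t => ∫ x, Real.exp (-t * x) ∂ρ)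
        (- ∫ x, x * Real.exp (-t * x) ∂ρ) t) ∧
    (∀ t > 0, HasDerivAt (fun t => - ∫ x, x * Real.exp (-t * x) ∂ρ)
        (∫ x, x ^ 2 * Real.exp (-t * x) ∂ρ) t) ∧
    (∀ t > 0, ∀ n : ℕ, Integrable (fun x => x ^ n * Real.exp (-t * x)) ρ) ∧
    (∀ t > 0, |∫ x, Real.exp (-t * x) ∂ρ| ≤ 1) ∧
    (∀ t > 0, |∫ x, x * Real.exp (-t * x) ∂ρ| ≤ ∫ x, x ∂ρ) ∧
    Tendsto (fun t => ∫ x, Real.exp (-t * x) ∂ρ) (𝓝[>] 0) (𝓝 1) := by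
  have hexp : ∀ t > (0:ℝ), ∀ x > (0:ℝ), Real.exp (-t * x) ≤ 1 := by
    intro t ht x hx
    rw [Real.exp_le_one_iff]
    nlinarith [mul_pos ht hx]
  have hI : ∀ t > 0, Integrable (fun x => Real.exp (-t * x)) ρ := by
    intro t ht
    refine Integrable.of_bound (C := 1) (Continuous.aestronglyMeasurable (by fun_prop)) ?_
    filter_upwards [hρ] with x hx
    rw [Real.norm_eq_abs, abs_of_pos (Real.exp_pos _)]
    exact hexp t ht x hx
  have hmem : ∀ t > (0:ℝ), -t ∈ interior (integrableExpSet (fun x : ℝ => x) ρ) := by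
    intro t ht
    rw [mem_interior]
    refine ⟨Iio 0, fun u hu => ?_, isOpen_Iio, by simpa using ht⟩
    have := hI (-u) (by simpa using hu)
    simpa [integrableExpSet] using this
  have hder : ∀ n : ℕ, ∀ t > (0:ℝ), HasDerivAt (fun t => ∫ x, x ^ n * Real.exp (-t * x) ∂ρ)
      (- ∫ x, x ^ (n + 1) * Real.exp (-t * x) ∂ρ) t := by
    intro n t ht
    have h1 := hasDerivAt_integral_pow_mul_exp_real (hmem t ht) n
    have h2 := HasDerivAt.comp t h1 (hasDerivAt_neg t)
    refine h2.congr_deriv ?_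
    simp
  refine ⟨fun t ht => ?_, fun t ht => ?_, fun t ht n => ?_, fun t ht => ?_, fun t ht => ?_, ?_⟩
  · simpa using hder 0 t ht
  · have h := HasDerivAt.fun_neg (hder 1 t ht)
    simpa using h
  · exact integrable_pow_mul_exp_of_mem_interior_integrableExpSet (hmem t ht) n
  · have := norm_integral_le_of_norm_le_const (μ := ρ) (f := fun x => Real.exp (-t * x)) (C := 1) ?_
    · simpa using this
    · filter_upwards [hρ] with x hx
      rw [Real.norm_eq_abs, abs_of_pos (Real.exp_pos _)]
      exact hexp t ht x hx
  · rw [← Real.norm_eq_abs]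
    refine norm_integral_le_of_norm_le hint ?_
    filter_upwards [hρ] with x hx
    rw [Real.norm_eq_abs, abs_of_pos (by positivity)]
    exact mul_le_of_le_one_right hx.le (hexp t ht x hx)
  · have : Tendsto (fun t => ∫ x, Real.exp (-t * x) ∂ρ) (𝓝[>] 0) (𝓝 (∫ x, 1 ∂ρ)) := by
      refine tendsto_integral_filter_of_dominated_convergence (fun _ => 1) ?_ ?_
        (integrable_const _) ?_
      · exact Eventually.of_forall fun t => Continuous.aestronglyMeasurable (by fun_prop)
      · filter_upwards [self_mem_nhdsWithin] with t ht
        filter_upwards [hρ] with x hx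
        rw [Real.norm_eq_abs, abs_of_pos (Real.exp_pos _)]
        exact hexp t ht x hx
      · refine Eventually.of_forall fun x => ?_
        have : Tendsto (fun t => Real.exp (-t * x)) (𝓝 0) (𝓝 (Real.exp (-0 * x))) :=
          Continuous.tendsto (by fun_prop) 0
        simpa using this.mono_left nhdsWithin_le_nhds
    simpa using this

lemma gg_law_unique (ρ σ : Measure ℝ) [IsProbabilityMeasure ρ] [IsProbabilityMeasure σ]
    (hρ : ∀ᵐ x ∂ρ, 0 < x) (hσ : ∀ᵐ x ∂σ, 0 < x)
    (hρi : Integrable (fun x : ℝ => x) ρ) (hσi : Integrable (fun x : ℝ => x) σ)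
    (a k q : ℝ) (ha : 0 < a) (hk : 0 < k) (hq : 0 ≤ q)
    (h1 : ∀ t > 0, ∫ x, (t ^ 2 * x ^ 2 - a * t * x + (q - k * x)) * Real.exp (-t * x) ∂ρ = 0)
    (h2 : ∀ t > 0, ∫ x, (t ^ 2 * x ^ 2 - a * t * x + (q - k * x)) * Real.exp (-t * x) ∂σ = 0) :
    ρ = σ := by
  have hsplit : ∀ (τ : Measure ℝ), (∀ t > 0, ∀ n : ℕ,
      Integrable (fun x => x ^ n * Real.exp (-t * x)) τ) → ∀ t > 0,
      ∫ x, (t ^ 2 * x ^ 2 - a * t * x + (q - k * x)) * Real.exp (-t * x) ∂τ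
      = t ^ 2 * (∫ x, x ^ 2 * Real.exp (-t * x) ∂τ)
        + (a * t + k) * (- ∫ x, x * Real.exp (-t * x) ∂τ) + q * ∫ x, Real.exp (-t * x) ∂τ := by
    intro τ hτ t ht
    have i2 := hτ t ht 2
    have i1 := hτ t ht 1
    have i0 := hτ t ht 0
    simp only [pow_one, pow_zero, one_mul] at i1 i0
    have i1' : Integrable (fun x => -(x * Real.exp (-t * x))) τ := i1.neg
    rw [← integral_neg, ← integral_const_mul, ← integral_const_mul, ← integral_const_mul,
      ← integral_add (i2.const_mul _) (i1'.const_mul _), ← integral_add _ (i0.const_mul _)]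
    · congr 1 with x
      ring
    · exact (i2.const_mul _).add (i1'.const_mul _)
  obtain ⟨a1, a2, a3, a4, a5, a6⟩ := gg_laplace_facts ρ hρ hρi
  obtain ⟨b1, b2, b3, b4, b5, b6⟩ := gg_laplace_facts σ hσ hσi
  apply gg_laplace_ext ρ σ hρ hσ
  have hm1 : 0 ≤ ∫ x, x ∂ρ := (abs_nonneg _).trans (a5 1 one_pos)
  have hm2 : 0 ≤ ∫ x, x ∂σ := (abs_nonneg _).trans (b5 1 one_pos)
  have := gg_ode_unique (fun t => (∫ x, Real.exp (-t * x) ∂ρ) - ∫ x, Real.exp (-t * x) ∂σ)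
    (fun t => (- ∫ x, x * Real.exp (-t * x) ∂ρ) - (- ∫ x, x * Real.exp (-t * x) ∂σ))
    (fun t => (∫ x, x ^ 2 * Real.exp (-t * x) ∂ρ) - ∫ x, x ^ 2 * Real.exp (-t * x) ∂σ)
    a k q (2 + (∫ x, x ∂ρ) + ∫ x, x ∂σ) ha hk hq
    (fun t ht => (a1 t ht).sub (b1 t ht)) (fun t ht => (a2 t ht).sub (b2 t ht)) ?_ ?_ ?_ ?_
  · intro t ht
    linarith [this t ht]
  · intro t ht
    have e1 := h1 t ht
    have e2 := h2 t ht
    rw [hsplit ρ a3 t ht] at e1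
    rw [hsplit σ b3 t ht] at e2
    linear_combination e1 - e2
  · intro t ht
    have := a4 t ht
    have := b4 t ht
    refine (abs_sub _ _).trans ?_
    linarith
  · intro t ht
    have := a5 t ht
    have := b5 t ht
    refine (abs_sub _ _).trans ?_
    rw [abs_neg, abs_neg]
    linarith
  · simpa using a6.sub b6

lemma gg_gamma_meas (r l : ℝ) : Measurable (fun x => ENNReal.ofReal (Set.indicator (Set.Ioi (0 : ℝ))
      (fun x => l ^ r * x ^ (r - 1) * Real.exp (-l * x) / Real.Gamma r) x)) := by
  refine ENNReal.measurable_ofReal.comp (Measurable.indicator ?_ measurableSet_Ioi)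
  fun_prop

lemma gg_dens_eq (r l : ℝ) (hr : 0 < r) (hl : 0 < l) (g : ℝ → ℝ) :
    (fun x => (ENNReal.ofReal (Set.indicator (Set.Ioi (0 : ℝ))
      (fun x => l ^ r * x ^ (r - 1) * Real.exp (-l * x) / Real.Gamma r) x)).toReal • g x)
    = Set.indicator (Set.Ioi (0 : ℝ))
      (fun x => (l ^ r / Real.Gamma r) * (x ^ (r - 1) * Real.exp (-l * x) * g x)) := by
  have := Real.Gamma_pos_of_pos hr
  ext x
  by_cases hx : x ∈ Ioi (0:ℝ)
  · have hx' : 0 < x := hx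
    rw [indicator_of_mem hx, indicator_of_mem hx, ENNReal.toReal_ofReal (by positivity), smul_eq_mul]
    ring
  · rw [indicator_of_notMem hx, indicator_of_notMem hx]
    simp

lemma gg_integral_gamma (r l : ℝ) (hr : 0 < r) (hl : 0 < l) (g : ℝ → ℝ) :
    ∫ x, g x ∂(gammaDist r l)
      = (l ^ r / Real.Gamma r) * ∫ x in Ioi 0, x ^ (r - 1) * Real.exp (-l * x) * g x := by
  rw [gammaDist, integral_withDensity_eq_integral_toReal_smul (gg_gamma_meas r l)
    (Eventually.of_forall fun x => ENNReal.ofReal_lt_top), gg_dens_eq r l hr hl,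
    integral_indicator measurableSet_Ioi, integral_const_mul]

lemma gg_integrable_gamma (r l : ℝ) (hr : 0 < r) (hl : 0 < l) (g : ℝ → ℝ) :
    Integrable g (gammaDist r l) ↔
      IntegrableOn (fun x => x ^ (r - 1) * Real.exp (-l * x) * g x) (Ioi 0) := by
  have := Real.Gamma_pos_of_pos hr
  have h : l ^ r / Real.Gamma r ≠ 0 := by positivity
  rw [gammaDist, integrable_withDensity_iff_integrable_smul' (gg_gamma_meas r l)
    (Eventually.of_forall fun x => ENNReal.ofReal_lt_top), gg_dens_eq r l hr hl,
    integrable_indicator_iff measurableSet_Ioi, IntegrableOn, IntegrableOn,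
    integrable_const_mul_iff h.isUnit]

lemma gg_gamma_pos (r l : ℝ) : ∀ᵐ x ∂(gammaDist r l), 0 < x := by
  rw [gammaDist, ae_withDensity_iff (gg_gamma_meas r l)]
  refine Eventually.of_forall fun x hx => ?_
  by_contra h
  apply hx
  rw [indicator_of_notMem (by simpa using h)]
  simp

lemma gg_gamma_moment (r l : ℝ) (hr : 0 < r) (hl : 0 < l) (n : ℕ) :
    Integrable (fun x : ℝ => x ^ n) (gammaDist r l) := by
  rw [gg_integrable_gamma r l hr hl]
  have h := integrableOn_rpow_mul_exp_neg_mul_rpow (p := 1) (s := r - 1 + n) (b := l)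
    (by have : (0:ℝ) ≤ n := by positivity
        linarith) one_pos hl
  refine h.congr_fun (fun x hx => ?_) measurableSet_Ioi
  simp only
  rw [Real.rpow_add hx, Real.rpow_one, Real.rpow_natCast]
  ring

lemma gg_gamma_ibp (r l : ℝ) (hr : 0 < r) (hl : 0 < l) [IsProbabilityMeasure (gammaDist r l)]
    (h b : ℝ → ℝ) (K : ℝ)
    (hm : Measurable h) (bm : Measurable b) (hd : ∀ x > 0, HasDerivAt h (b x / x) x)
    (hK : ∀ x, |h x| ≤ K) (bK : ∀ x, |b x| ≤ K) :
    ∫ x, (b x + r * h x) ∂(gammaDist r l) = l * ∫ x, x * h x ∂(gammaDist r l) := by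
  have hi : Integrable h (gammaDist r l) :=
    Integrable.of_bound hm.aestronglyMeasurable K (Eventually.of_forall hK)
  have bi : Integrable b (gammaDist r l) :=
    Integrable.of_bound bm.aestronglyMeasurable K (Eventually.of_forall bK)
  have xi : Integrable (fun x => x * h x) (gammaDist r l) := by
    have := gg_gamma_moment r l hr hl 1
    simp only [pow_one] at this
    exact this.mul_bdd (c := K) hm.aestronglyMeasurable (Eventually.of_forall hK)
  have bhi : Integrable (fun x => b x + r * h x) (gammaDist r l) := bi.add (hi.const_mul r)
  rw [← integral_const_mul, ← sub_eq_zero,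
    ← integral_sub bhi (xi.const_mul l), gg_integral_gamma r l hr hl]
  have hint := (gg_integrable_gamma r l hr hl (fun x => b x + r * h x - l * (x * h x))).1 (bhi.sub (xi.const_mul l))
  have hz : ∫ x in Ioi 0, x ^ (r - 1) * Real.exp (-l * x) * (b x + r * h x - l * (x * h x))
      = 0 - (fun x : ℝ => x ^ r * Real.exp (-l * x) * h x) 0 := by
    refine integral_Ioi_of_hasDerivAt_of_tendsto (m := 0)
      (f := fun x : ℝ => x ^ r * Real.exp (-l * x) * h x) ?_ ?_ hint ?_
    · rw [ContinuousWithinAt, Real.zero_rpow hr.ne', zero_mul, zero_mul]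
      refine squeeze_zero_norm' (a := fun x : ℝ => x ^ r * Real.exp (-l * x) * K) ?_ ?_
      · filter_upwards [self_mem_nhdsWithin] with x hx
        have hx : (0:ℝ) ≤ x := hx
        rw [norm_mul, Real.norm_of_nonneg (by positivity)]
        gcongr
        exact hK x
      · have : Continuous (fun x : ℝ => x ^ r * Real.exp (-l * x) * K) :=
          ((Real.continuous_rpow_const hr.le).mul (by fun_prop)).mul continuous_const
        have := this.tendsto 0
        rw [Real.zero_rpow hr.ne', zero_mul, zero_mul] at this
        exact this.mono_left nhdsWithin_le_nhds
    · intro x hx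
      have hx : (0:ℝ) < x := hx
      have h1 := Real.hasDerivAt_rpow_const (x := x) (p := r) (Or.inl hx.ne')
      have h2 : HasDerivAt (fun x => Real.exp (-l * x)) (Real.exp (-l * x) * (-l * 1)) x :=
        ((hasDerivAt_id x).const_mul (-l)).exp
      refine ((h1.mul h2).mul (hd x hx)).congr_deriv ?_
      simp only [Pi.mul_apply]
      rw [Real.rpow_sub_one hx.ne']
      field_simp
      ring
    · refine squeeze_zero_norm' (a := fun x : ℝ => x ^ r * Real.exp (-l * x) * K) ?_ ?_
      · filter_upwards [eventually_ge_atTop 0] with x hx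
        rw [norm_mul, Real.norm_of_nonneg (by positivity)]
        gcongr
        exact hK x
      · have := (tendsto_rpow_mul_exp_neg_mul_atTop_nhds_zero r l hl).mul_const K
        simpa using this
  have hz' : (0:ℝ) - (fun x : ℝ => x ^ r * Real.exp (-l * x) * h x) 0 = 0 := by
    simp [Real.zero_rpow hr.ne']
  rw [hz'] at hz
  simp only [hz, mul_zero]

lemma gg_core (r s l : ℝ) (hr : 0 < r) (hs : 0 < s) (hl : 0 < l)
    [IsProbabilityMeasure (gammaDist r l)] [IsProbabilityMeasure (gammaDist s l)]
    (a b c : ℝ → ℝ) (K : ℝ) (am : Measurable a) (bm : Measurable b) (cm : Measurable c)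
    (ad : ∀ x > 0, HasDerivAt a (b x / x) x) (bd : ∀ x > 0, HasDerivAt b (c x / x) x)
    (aK : ∀ x, |a x| ≤ K) (bK : ∀ x, |b x| ≤ K) (cK : ∀ x, |c x| ≤ K) :
    ∫ p : ℝ × ℝ, (c (p.1 * p.2) + (r + s) * b (p.1 * p.2)
      + (r * s - l ^ 2 * (p.1 * p.2)) * a (p.1 * p.2))
        ∂((gammaDist r l).prod (gammaDist s l)) = 0 := by
  set γ₁ := gammaDist r l
  set γ₂ := gammaDist s l
  have hK0 : 0 ≤ K := (abs_nonneg _).trans (aK 0)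
  have i1 : Integrable (fun x : ℝ => x) γ₁ := by simpa using gg_gamma_moment r l hr hl 1
  have i2 : Integrable (fun x : ℝ => x) γ₂ := by simpa using gg_gamma_moment s l hs hl 1
  have mmul : Measurable (fun p : ℝ × ℝ => p.1 * p.2) := by fun_prop
  have hI0 : ∀ g : ℝ → ℝ, Measurable g → (∀ x, |g x| ≤ K) →
      Integrable (fun p : ℝ × ℝ => g (p.1 * p.2)) (γ₁.prod γ₂) := fun g gm gK =>
    Integrable.of_bound (gm.comp mmul).aestronglyMeasurable K (Eventually.of_forall fun p => gK _)
  have hI1 : ∀ g : ℝ → ℝ, Measurable g → (∀ x, |g x| ≤ K) →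
      Integrable (fun p : ℝ × ℝ => p.1 * g (p.1 * p.2)) (γ₁.prod γ₂) := by
    intro g gm gK
    exact (i1.comp_fst γ₂).mul_bdd (c := K) (gm.comp mmul).aestronglyMeasurable
      (Eventually.of_forall fun p => gK _)
  have hI2 : ∀ g : ℝ → ℝ, Measurable g → (∀ x, |g x| ≤ K) →
      Integrable (fun p : ℝ × ℝ => p.1 * p.2 * g (p.1 * p.2)) (γ₁.prod γ₂) := by
    intro g gm gK
    exact (i1.mul_prod i2).mul_bdd (c := K) (gm.comp mmul).aestronglyMeasurable
      (Eventually.of_forall fun p => gK _)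
  have scale1 : ∀ (u v : ℝ → ℝ), (∀ x > 0, HasDerivAt u (v x / x) x) → ∀ z > 0, ∀ x > 0,
      HasDerivAt (fun x => u (x * z)) (v (x * z) / x) x := by
    intro u v huv z hz x hx
    have h1 := HasDerivAt.comp x (huv (x * z) (by positivity)) ((hasDerivAt_id x).mul_const z)
    refine h1.congr_deriv ?_
    field_simp
  have scale2 : ∀ (u v : ℝ → ℝ), (∀ x > 0, HasDerivAt u (v x / x) x) → ∀ x > 0, ∀ z > 0,
      HasDerivAt (fun z => u (x * z)) (v (x * z) / z) z := by
    intro u v huv x hx z hz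
    have := scale1 u v huv x hx z hz
    simpa only [mul_comm z x, mul_comm _ x] using this
  have habs : ∀ (x y m : ℝ), 0 ≤ m → |x| ≤ K → |y| ≤ K → |x + m * y| ≤ K + m * K := by
    intro x y m hm hx hy
    refine (abs_add_le _ _).trans ?_
    rw [abs_mul, abs_of_nonneg hm]
    gcongr
  -- step 1
  have s1 : ∫ p : ℝ × ℝ, ((c (p.1 * p.2) + s * b (p.1 * p.2))
        + r * (b (p.1 * p.2) + s * a (p.1 * p.2))) ∂(γ₁.prod γ₂)
      = ∫ p : ℝ × ℝ, l * (p.1 * (b (p.1 * p.2) + s * a (p.1 * p.2))) ∂(γ₁.prod γ₂) := by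
    rw [integral_prod_symm, integral_prod_symm]
    · refine integral_congr_ae ?_
      filter_upwards [gg_gamma_pos s l] with z hz
      rw [integral_const_mul]
      refine gg_gamma_ibp r l hr hl (fun x => b (x * z) + s * a (x * z))
        (fun x => c (x * z) + s * b (x * z)) (K + s * K) (by fun_prop) (by fun_prop) ?_ ?_ ?_
      · intro x hx
        refine ((scale1 b c bd z hz x hx).add ((scale1 a b ad z hz x hx).const_mul s)).congr_deriv ?_
        ring
      · exact fun x => habs _ _ _ hs.le (bK _) (aK _)
      · exact fun x => habs _ _ _ hs.le (cK _) (bK _)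
    · have := ((hI1 b bm bK).add ((hI1 a am aK).const_mul s)).const_mul l
      refine this.congr (Eventually.of_forall fun p => ?_)
      simp only [Pi.add_apply]
      ring
    · exact ((hI0 c cm cK).add ((hI0 b bm bK).const_mul s)).add
        (((hI0 b bm bK).add ((hI0 a am aK).const_mul s)).const_mul r)
  have s2 : ∫ p : ℝ × ℝ, l * (p.1 * (b (p.1 * p.2) + s * a (p.1 * p.2))) ∂(γ₁.prod γ₂)
      = ∫ p : ℝ × ℝ, l ^ 2 * (p.1 * p.2 * a (p.1 * p.2)) ∂(γ₁.prod γ₂) := by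
    rw [integral_prod, integral_prod]
    · refine integral_congr_ae ?_
      filter_upwards [gg_gamma_pos r l] with x hx
      have := gg_gamma_ibp s l hs hl (fun z => a (x * z))
        (fun z => b (x * z)) K (by fun_prop) (by fun_prop) (scale2 a b ad x hx)
          (fun _ => aK _) (fun _ => bK _)
      rw [integral_const_mul, integral_const_mul, this, ← integral_const_mul, ← integral_const_mul,
        ← integral_const_mul]
      congr 1 with z
      ring
    · exact (hI2 a am aK).const_mul _
    · have := ((hI1 b bm bK).add ((hI1 a am aK).const_mul s)).const_mul l
      refine this.congr (Eventually.of_forall fun p => ?_)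
      simp only [Pi.add_apply]
      ring
  have s3 := s1.trans s2
  rw [← sub_eq_zero, ← integral_sub] at s3
  · rw [← s3]
    congr 1 with p
    ring
  · exact ((hI0 c cm cK).add ((hI0 b bm bK).const_mul s)).add
        (((hI0 b bm bK).add ((hI0 a am aK).const_mul s)).const_mul r)
  · exact (hI2 a am aK).const_mul _

lemma gg_bump : ∃ (φ φ1 φ2 : ℝ → ℝ) (K : ℝ), 1 ≤ K ∧ Continuous φ ∧ Continuous φ1 ∧ Continuous φ2 ∧
    (∀ u, HasDerivAt φ (φ1 u) u) ∧ (∀ u, HasDerivAt φ1 (φ2 u) u) ∧ φ 0 = 1 ∧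
    (∀ u, 2 < |u| → φ u = 0 ∧ φ1 u = 0 ∧ φ2 u = 0) ∧
    (∀ u, |φ u| ≤ K ∧ |φ1 u| ≤ K ∧ |φ2 u| ≤ K) := by
  let f : ContDiffBump (0 : ℝ) := ⟨1, 2, one_pos, one_lt_two⟩
  have hf : ContDiff ℝ 2 (f : ℝ → ℝ) := f.contDiff
  have hf1 : ContDiff ℝ 1 (deriv (f : ℝ → ℝ)) := by
    have h2 : ContDiff ℝ (1 + 1) (f : ℝ → ℝ) := by simpa [one_add_one_eq_two] using hf
    exact (contDiff_succ_iff_deriv.1 h2).2.2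
  have hf2 : Continuous (deriv (deriv (f : ℝ → ℝ))) := hf1.continuous_deriv le_rfl
  have hs0 : HasCompactSupport (f : ℝ → ℝ) := f.hasCompactSupport
  have hs1 := hs0.deriv
  have hs2 := hs1.deriv
  obtain ⟨C0, hC0⟩ := hs0.exists_bound_of_continuous hf.continuous
  obtain ⟨C1, hC1⟩ := hs1.exists_bound_of_continuous hf1.continuous
  obtain ⟨C2, hC2⟩ := hs2.exists_bound_of_continuous hf2
  refine ⟨f, deriv f, deriv (deriv f), max 1 (max C0 (max C1 C2)), le_max_left _ _, hf.continuous,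
    hf1.continuous, hf2, ?_, ?_, ?_, ?_, ?_⟩
  · exact fun u => (hf.differentiable (by norm_num) u).hasDerivAt
  · exact fun u => (hf1.differentiable (by norm_num) u).hasDerivAt
  · exact f.one_of_mem_closedBall (by simp [f])
  · intro u hu
    have h0 : u ∉ tsupport (f : ℝ → ℝ) := by
      rw [f.tsupport_eq]
      simpa [f] using hu
    have t1 : tsupport (deriv (f : ℝ → ℝ)) ⊆ tsupport (f : ℝ → ℝ) :=
      closure_minimal support_deriv_subset (isClosed_tsupport _)
    have t2 : tsupport (deriv (deriv (f : ℝ → ℝ))) ⊆ tsupport (deriv (f : ℝ → ℝ)) :=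
      closure_minimal support_deriv_subset (isClosed_tsupport _)
    exact ⟨image_eq_zero_of_notMem_tsupport h0,
      image_eq_zero_of_notMem_tsupport fun h => h0 (t1 h),
      image_eq_zero_of_notMem_tsupport fun h => h0 (t1 (t2 h))⟩
  · intro u
    refine ⟨(hC0 u).trans ?_, (hC1 u).trans ?_, (hC2 u).trans ?_⟩ <;> simp

noncomputable def ggP (g φ : ℝ → ℝ) (e : ℝ) (y : ℝ) : ℝ :=
  Set.indicator (Ioi (0:ℝ)) (fun y => g y * φ (e * Real.log y)) y

lemma ggP_pos (g φ : ℝ → ℝ) (e y : ℝ) (hy : 0 < y) : ggP g φ e y = g y * φ (e * Real.log y) :=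
  indicator_of_mem (show y ∈ Ioi (0:ℝ) from hy) _

lemma ggP_meas (g φ : ℝ → ℝ) (e : ℝ) (hg : Measurable g) (hφ : Continuous φ) :
    Measurable (ggP g φ e) := by
  refine Measurable.indicator ?_ measurableSet_Ioi
  exact hg.mul (hφ.measurable.comp (by fun_prop))

lemma ggP_bdd (g φ : ℝ → ℝ) (e : ℝ) (he : 0 < e) (hg : ContinuousOn g (Ioi 0)) (hφ : Continuous φ)
    (hsupp : ∀ u, 2 < |u| → φ u = 0) : ∃ K, ∀ y, |ggP g φ e y| ≤ K := by
  have hsub : Icc (Real.exp (-(2/e))) (Real.exp (2/e)) ⊆ Ioi (0:ℝ) :=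
    fun y hy => (Real.exp_pos _).trans_le hy.1
  have hc : ContinuousOn (fun y => g y * φ (e * Real.log y))
      (Icc (Real.exp (-(2/e))) (Real.exp (2/e))) := by
    refine (hg.mono hsub).mul (hφ.comp_continuousOn (continuousOn_const.mul ?_))
    exact Real.continuousOn_log.mono fun y hy => (hsub hy).ne'
  obtain ⟨K, hK⟩ := isCompact_Icc.exists_bound_of_continuousOn hc
  refine ⟨max K 0, fun y => ?_⟩
  by_cases hy : 0 < y
  · rw [ggP_pos _ _ _ _ hy]
    by_cases hy2 : y ∈ Icc (Real.exp (-(2/e))) (Real.exp (2/e))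
    · exact (hK y hy2).trans (le_max_left _ _)
    · rw [hsupp, mul_zero, abs_zero]
      · exact le_max_right _ _
      · by_contra h
        apply hy2
        push Not at h
        rw [abs_mul, abs_of_pos he, ← le_div_iff₀' he, abs_le] at h
        rw [mem_Icc, ← Real.le_log_iff_exp_le hy, ← Real.log_le_iff_le_exp hy]
        exact h
  · rw [ggP, indicator_of_notMem (by simpa using hy)]
    simp

lemma gg_extend (ρ : Measure ℝ) (r s l : ℝ) (hρ : ∀ᵐ y ∂ρ, 0 < y)
    (H : ∀ (a b c : ℝ → ℝ) (K : ℝ), Measurable a → Measurable b → Measurable c →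
      (∀ x > 0, HasDerivAt a (b x / x) x) → (∀ x > 0, HasDerivAt b (c x / x) x) →
      (∀ x, |a x| ≤ K) → (∀ x, |b x| ≤ K) → (∀ x, |c x| ≤ K) →
      ∫ y, (c y + (r + s) * b y + (r * s - l ^ 2 * y) * a y) ∂ρ = 0)
    (a b c : ℝ → ℝ) (am : Measurable a) (bm : Measurable b) (cm : Measurable c)
    (ad : ∀ x > 0, HasDerivAt a (b x / x) x) (bd : ∀ x > 0, HasDerivAt b (c x / x) x)
    (cc : ContinuousOn c (Ioi 0))
    (ai : Integrable a ρ) (bi : Integrable b ρ) (ci : Integrable c ρ)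
    (yi : Integrable (fun y => y * a y) ρ) :
    ∫ y, (c y + (r + s) * b y + (r * s - l ^ 2 * y) * a y) ∂ρ = 0 := by
  obtain ⟨φ, φ1, φ2, K, hK1, hφ, hφ1, hφ2, hd, hd1, hφ0, hsupp, hbd⟩ := gg_bump
  have ac : ContinuousOn a (Ioi 0) := fun y hy => (ad y hy).continuousAt.continuousWithinAt
  have bc : ContinuousOn b (Ioi 0) := fun y hy => (bd y hy).continuousAt.continuousWithinAt
  set A : ℝ → ℝ → ℝ := fun e y => ggP a φ e y with hA
  set B : ℝ → ℝ → ℝ := fun e y => ggP b φ e y + e * ggP a φ1 e y with hB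
  set C : ℝ → ℝ → ℝ := fun e y => ggP c φ e y + (2 * e) * ggP b φ1 e y + e ^ 2 * ggP a φ2 e y with hC
  have hPd : ∀ (g g' ψ ψ' : ℝ → ℝ) (e : ℝ), (∀ x > 0, HasDerivAt g (g' x / x) x) →
      (∀ u, HasDerivAt ψ (ψ' u) u) → ∀ x > 0,
      HasDerivAt (ggP g ψ e) ((ggP g' ψ e x + e * ggP g ψ' e x) / x) x := by
    intro g g' ψ ψ' e hg hψ x hx
    have h1 : HasDerivAt (fun y => e * Real.log y) (e * x⁻¹) x :=
      (Real.hasDerivAt_log hx.ne').const_mul e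
    have h2 := (hg x hx).mul (HasDerivAt.comp x (hψ (e * Real.log x)) h1)
    have h3 : HasDerivAt (ggP g ψ e) _ x := h2.congr_of_eventuallyEq (by
      filter_upwards [Ioi_mem_nhds hx] with y hy
      rw [ggP_pos _ _ _ _ hy]
      rfl)
    refine h3.congr_deriv ?_
    rw [ggP_pos _ _ _ _ hx, ggP_pos _ _ _ _ hx]
    simp only [Function.comp]
    field_simp
  have hzero : ∀ e > 0, ∫ y, (C e y + (r + s) * B e y + (r * s - l ^ 2 * y) * A e y) ∂ρ = 0 := by
    intro e he
    obtain ⟨k1, hk1⟩ := ggP_bdd a φ e he ac hφ (fun u hu => (hsupp u hu).1)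
    obtain ⟨k2, hk2⟩ := ggP_bdd b φ e he bc hφ (fun u hu => (hsupp u hu).1)
    obtain ⟨k3, hk3⟩ := ggP_bdd c φ e he cc hφ (fun u hu => (hsupp u hu).1)
    obtain ⟨k4, hk4⟩ := ggP_bdd a φ1 e he ac hφ1 (fun u hu => (hsupp u hu).2.1)
    obtain ⟨k5, hk5⟩ := ggP_bdd b φ1 e he bc hφ1 (fun u hu => (hsupp u hu).2.1)
    obtain ⟨k6, hk6⟩ := ggP_bdd a φ2 e he ac hφ2 (fun u hu => (hsupp u hu).2.2)
    have p1 := (abs_nonneg _).trans (hk1 0)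
    have p2 := (abs_nonneg _).trans (hk2 0)
    have p3 := (abs_nonneg _).trans (hk3 0)
    have p4 := (abs_nonneg _).trans (hk4 0)
    have p5 := (abs_nonneg _).trans (hk5 0)
    have p6 := (abs_nonneg _).trans (hk6 0)
    have m1 := ggP_meas a φ e am hφ
    have m2 := ggP_meas b φ e bm hφ
    have m3 := ggP_meas c φ e cm hφ
    have m4 := ggP_meas a φ1 e am hφ1
    have m5 := ggP_meas b φ1 e bm hφ1
    have m6 := ggP_meas a φ2 e am hφ2
    have q4 : 0 ≤ e * k4 := by positivity
    have q5 : 0 ≤ 2 * e * k5 := by positivity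
    have q6 : 0 ≤ e ^ 2 * k6 := by positivity
    refine H (A e) (B e) (C e) (k1 + (k2 + e * k4) + (k3 + (2 * e) * k5 + e ^ 2 * k6)) m1 ?_ ?_ ?_ ?_ ?_ ?_ ?_
    · exact m2.add (m4.const_mul e)
    · exact (m3.add (m5.const_mul _)).add (m6.const_mul _)
    · exact hPd a b φ φ1 e ad hd
    · intro x hx
      refine ((hPd b c φ φ1 e bd hd x hx).add ((hPd a b φ1 φ2 e ad hd1 x hx).const_mul e)).congr_deriv ?_
      simp only [hC]
      ring
    · intro x
      refine (hk1 x).trans ?_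
      linarith
    · intro x
      have : |B e x| ≤ k2 + e * k4 := by
        refine (abs_add_le _ _).trans ?_
        rw [abs_mul, abs_of_pos he]
        gcongr
        · exact hk2 x
        · exact hk4 x
      linarith
    · intro x
      have : |C e x| ≤ k3 + (2 * e) * k5 + e ^ 2 * k6 := by
        refine (abs_add_le _ _).trans (add_le_add ((abs_add_le _ _).trans (add_le_add (hk3 x) ?_)) ?_)
        · rw [abs_mul, abs_of_pos (by positivity)]
          gcongr
          exact hk5 x
        · rw [abs_mul, abs_of_pos (by positivity)]
          gcongr
          exact hk6 x
      linarith
  have hlim : Tendsto (fun e => ∫ y, (C e y + (r + s) * B e y + (r * s - l ^ 2 * y) * A e y) ∂ρ)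
      (𝓝[>] 0) (𝓝 (∫ y, (c y + (r + s) * b y + (r * s - l ^ 2 * y) * a y) ∂ρ)) := by
    refine tendsto_integral_filter_of_dominated_convergence
      (fun y => K * (|c y| + 2 * |b y| + |a y|) + |r + s| * (K * (|b y| + |a y|))
        + K * (|r * s| * |a y| + l ^ 2 * |y * a y|)) ?_ ?_ ?_ ?_
    · refine Eventually.of_forall fun e => Measurable.aestronglyMeasurable ?_
      have m1 := ggP_meas a φ e am hφ
      have m2 := ggP_meas b φ e bm hφ
      have m3 := ggP_meas c φ e cm hφ
      have m4 := ggP_meas a φ1 e am hφ1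
      have m5 := ggP_meas b φ1 e bm hφ1
      have m6 := ggP_meas a φ2 e am hφ2
      simp only [hA, hB, hC]
      fun_prop
    · filter_upwards [Ioo_mem_nhdsGT (one_pos : (0:ℝ) < 1)] with e he
      have he0 : 0 < e := he.1
      have he1 : e ≤ 1 := he.2.le
      filter_upwards [hρ] with y hy
      have hP : ∀ (g ψ : ℝ → ℝ), (∀ u, |ψ u| ≤ K) → |ggP g ψ e y| ≤ K * |g y| := by
        intro g ψ hψ
        rw [ggP_pos _ _ _ _ hy, abs_mul, mul_comm]
        gcongr
        exact hψ _
      have x1 := hP a φ fun u => (hbd u).1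
      have x2 := hP b φ fun u => (hbd u).1
      have x3 := hP c φ fun u => (hbd u).1
      have x4 := hP a φ1 fun u => (hbd u).2.1
      have x5 := hP b φ1 fun u => (hbd u).2.1
      have x6 := hP a φ2 fun u => (hbd u).2.2
      have he2 : e ^ 2 ≤ 1 := pow_le_one₀ he0.le he1
      have y1 : |C e y| ≤ K * (|c y| + 2 * |b y| + |a y|) := by
        have : |C e y| ≤ K * |c y| + 2 * (K * |b y|) + 1 * (K * |a y|) := by
          refine (abs_add_le _ _).trans (add_le_add ((abs_add_le _ _).trans (add_le_add x3 ?_)) ?_)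
          · rw [abs_mul, abs_of_pos (by positivity)]
            gcongr
            linarith
          · rw [abs_mul, abs_of_pos (by positivity)]
            gcongr
        linarith
      have y2 : |B e y| ≤ K * (|b y| + |a y|) := by
        have : |B e y| ≤ K * |b y| + 1 * (K * |a y|) := by
          refine (abs_add_le _ _).trans (add_le_add x2 ?_)
          rw [abs_mul, abs_of_pos he0]
          gcongr
        linarith
      have y3 : |(r * s - l ^ 2 * y) * A e y| ≤ K * (|r * s| * |a y| + l ^ 2 * |y * a y|) := by
        rw [abs_mul]
        calc |r * s - l ^ 2 * y| * |A e y| ≤ (|r * s| + l ^ 2 * y) * (K * |a y|) := by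
              gcongr
              refine (abs_sub _ _).trans ?_
              rw [abs_of_nonneg (show 0 ≤ l ^ 2 * y by positivity)]
          _ = _ := by rw [abs_mul y, abs_of_pos hy]; ring
      rw [Real.norm_eq_abs]
      refine (abs_add_le _ _).trans (add_le_add ((abs_add_le _ _).trans (add_le_add y1 ?_)) y3)
      rw [abs_mul]
      gcongr
    · have := ai.abs
      have := bi.abs
      have := ci.abs
      have := yi.abs
      fun_prop
    · filter_upwards [hρ] with y hy
      have hP : ∀ (g ψ : ℝ → ℝ), Continuous ψ →
          Tendsto (fun e => ggP g ψ e y) (𝓝[>] 0) (𝓝 (g y * ψ 0)) := by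
        intro g ψ hψ
        simp_rw [ggP_pos _ _ _ _ hy]
        have : Tendsto (fun e => g y * ψ (e * Real.log y)) (𝓝 0) (𝓝 (g y * ψ (0 * Real.log y))) :=
          Continuous.tendsto (by fun_prop) 0
        rw [zero_mul] at this
        exact this.mono_left nhdsWithin_le_nhds
      have te : Tendsto (fun e : ℝ => e) (𝓝[>] 0) (𝓝 0) := nhdsWithin_le_nhds
      have t1 := hP a φ hφ
      have t2 := hP b φ hφ
      have t3 := hP c φ hφ
      have t4 := hP a φ1 hφ1
      have t5 := hP b φ1 hφ1
      have t6 := hP a φ2 hφ2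
      have := ((t3.add ((te.const_mul 2).mul t5)).add ((te.pow 2).mul t6)).add
        ((t2.add (te.mul t4)).const_mul (r + s)) |>.add (t1.const_mul (r * s - l ^ 2 * y))
      simpa [hφ0] using this
  refine tendsto_nhds_unique hlim ?_
  refine tendsto_const_nhds.congr' ?_
  filter_upwards [self_mem_nhdsWithin] with e he
  exact (hzero e he).symm

lemma gg_ind_meas (g : ℝ → ℝ) (hg : ContinuousOn g (Ioi 0)) :
    Measurable (Set.indicator (Ioi (0:ℝ)) g) := by
  classical
  rw [← Set.piecewise_eq_indicator]
  exact hg.measurable_piecewise continuousOn_const measurableSet_Ioi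

lemma gg_stein_zero {Ω : Type*} [MeasurableSpace Ω] (μ : Measure Ω) (Y : Ω → ℝ) (hY : Measurable Y)
    (r s l : ℝ) (hpos : ∀ᵐ y ∂(Measure.map Y μ), 0 < y)
    (H : ∀ (a b c : ℝ → ℝ) (K : ℝ), Measurable a → Measurable b → Measurable c →
      (∀ x > 0, HasDerivAt a (b x / x) x) → (∀ x > 0, HasDerivAt b (c x / x) x) →
      (∀ x, |a x| ≤ K) → (∀ x, |b x| ≤ K) → (∀ x, |c x| ≤ K) →
      ∫ y, (c y + (r + s) * b y + (r * s - l ^ 2 * y) * a y) ∂(Measure.map Y μ) = 0)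
    (f : ℝ → ℝ) (hf : memFGG μ Y f) :
    ∃ T : ℝ → ℝ, Measurable T ∧ (∀ y > 0, steinGammaGamma r s l f y = T y) ∧
      ∫ y, T y ∂(Measure.map Y μ) = 0 := by
  obtain ⟨hc, hi⟩ := hf
  have hposω := ae_of_ae_map hY.aemeasurable hpos
  set g1 := derivWithin f (Ioi 0) with hg1
  set g2 := iteratedDerivWithin 2 f (Ioi 0) with hg2
  have hu : UniqueDiffOn ℝ (Ioi (0:ℝ)) := uniqueDiffOn_Ioi 0
  have c0 : ContinuousOn f (Ioi 0) := hc.continuousOn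
  have c1 : ContinuousOn g1 (Ioi 0) := by
    have := hc.continuousOn_iteratedDerivWithin (m := 1) (by norm_num) hu
    rwa [iteratedDerivWithin_one] at this
  have c2 : ContinuousOn g2 (Ioi 0) :=
    hc.continuousOn_iteratedDerivWithin (m := 2) (by norm_num) hu
  have d0 : ∀ y > 0, HasDerivAt f (g1 y) y := by
    intro y hy
    have := (hc.differentiableOn (by norm_num) y hy).hasDerivWithinAt
    exact this.hasDerivAt (Ioi_mem_nhds hy)
  have d1 : ∀ y > 0, HasDerivAt g1 (g2 y) y := by
    intro y hy
    have h := hc.differentiableOn_iteratedDerivWithin (m := 1) (by norm_num) hu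
    rw [iteratedDerivWithin_one] at h
    have := (h y hy).hasDerivWithinAt
    have e : g2 y = derivWithin g1 (Ioi 0) y := by
      rw [hg2, iteratedDerivWithin_succ, iteratedDerivWithin_one]
    rw [e]
    exact this.hasDerivAt (Ioi_mem_nhds hy)
  set a := Set.indicator (Ioi (0:ℝ)) f with ha
  set b := Set.indicator (Ioi (0:ℝ)) (fun y => y * g1 y) with hb
  set c := Set.indicator (Ioi (0:ℝ)) (fun y => y ^ 2 * g2 y + y * g1 y) with hcc
  have ea : ∀ y > 0, a y = f y := fun y hy => indicator_of_mem (show y ∈ Ioi (0:ℝ) from hy) _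
  have eb : ∀ y > 0, b y = y * g1 y := fun y hy => indicator_of_mem (show y ∈ Ioi (0:ℝ) from hy) _
  have ec : ∀ y > 0, c y = y ^ 2 * g2 y + y * g1 y :=
    fun y hy => indicator_of_mem (show y ∈ Ioi (0:ℝ) from hy) _
  have cc' : ContinuousOn (fun y => y ^ 2 * g2 y + y * g1 y) (Ioi 0) := by fun_prop
  have am : Measurable a := gg_ind_meas _ c0
  have bm : Measurable b := gg_ind_meas _ (by fun_prop)
  have cm : Measurable c := gg_ind_meas _ cc'
  have hint : ∀ (u : ℝ → ℝ) (v : Ω → ℝ), Measurable u → Integrable v μ →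
      (∀ᵐ ω ∂μ, v ω = u (Y ω)) → Integrable u (Measure.map Y μ) := by
    intro u v hu hv huv
    rw [integrable_map_measure hu.aestronglyMeasurable hY.aemeasurable]
    exact hv.congr huv
  have i00 := hi 0 (by norm_num) 0 (by norm_num)
  have i01 := hi 0 (by norm_num) 1 (by norm_num)
  have i11 := hi 1 (by norm_num) 1 (by norm_num)
  have i22 := hi 2 (by norm_num) 2 (by norm_num)
  rw [iteratedDerivWithin_one] at i11
  rw [iteratedDerivWithin_zero] at i00 i01
  refine ⟨fun y => c y + (r + s) * b y + (r * s - l ^ 2 * y) * a y, by fun_prop, ?_, ?_⟩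
  · intro y hy
    simp only [steinGammaGamma]
    rw [ea y hy, eb y hy, ec y hy]
    ring
  · refine gg_extend (Measure.map Y μ) r s l hpos H a b c am bm cm ?_ ?_ ?_ ?_ ?_ ?_ ?_
    · intro y hy
      have h : HasDerivAt a _ y := (d0 y hy).congr_of_eventuallyEq (by
        filter_upwards [Ioi_mem_nhds hy] with z hz using ea z hz)
      refine h.congr_deriv ?_
      rw [eb y hy]
      field_simp
    · intro y hy
      have h0 := (hasDerivAt_id y).mul (d1 y hy)
      have h : HasDerivAt b _ y := h0.congr_of_eventuallyEq (by
        filter_upwards [Ioi_mem_nhds hy] with z hz using eb z hz)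
      refine h.congr_deriv ?_
      rw [ec y hy]
      simp only [id]
      field_simp
      ring
    · exact cc'.congr fun y hy => ec y hy
    · refine hint _ _ am i00 ?_
      filter_upwards [hposω] with ω hω
      rw [ea _ hω]; simp
    · refine hint _ _ bm i11 ?_
      filter_upwards [hposω] with ω hω
      rw [eb _ hω]; simp [hg1]
    · refine hint _ _ cm (i22.add i11) ?_
      filter_upwards [hposω] with ω hω
      rw [ec _ hω]; simp [hg1, hg2]
    · refine hint _ _ (by fun_prop) i01 ?_
      filter_upwards [hposω] with ω hω
      rw [ea _ hω]; simp

/-- Stein characterisation of the product of independent `Γ(r,l)` and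
`Γ(s,l)` random variables. -/
theorem stein_characterisation_gamma_times_gamma
    {Ω Ω' : Type*} [MeasurableSpace Ω] [MeasurableSpace Ω']
    (μ : Measure Ω) [IsProbabilityMeasure μ] (ν : Measure Ω') [IsProbabilityMeasure ν]
    (r s l : ℝ) (hr : 0 < r) (hs : 0 < s) (hl : 0 < l)
    (G₁ G₂ : Ω → ℝ) (hG₁ : Measurable G₁) (hG₂ : Measurable G₂)
    (hindep : IndepFun G₁ G₂ μ)
    (hG₁law : Measure.map G₁ μ = gammaDist r l)
    (hG₂law : Measure.map G₂ μ = gammaDist s l)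
    (W : Ω' → ℝ) (hW : Measurable W)
    (hWmom : Integrable (fun ω => (W ω) ^ 2) ν) :
    Measure.map W ν = Measure.map (fun ω => G₁ ω * G₂ ω) μ ↔
      ∀ f : ℝ → ℝ, memFGG μ (fun ω => G₁ ω * G₂ ω) f →
        ∫ ω, steinGammaGamma r s l f (W ω) ∂ν = 0 := by
  classical
  have pm1 : IsProbabilityMeasure (gammaDist r l) :=
    hG₁law ▸ Measure.isProbabilityMeasure_map hG₁.aemeasurable
  have pm2 : IsProbabilityMeasure (gammaDist s l) :=
    hG₂law ▸ Measure.isProbabilityMeasure_map hG₂.aemeasurable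
  set Y : Ω → ℝ := fun ω => G₁ ω * G₂ ω with hYdef
  have hY : Measurable Y := hG₁.mul hG₂
  have mmul : Measurable (fun p : ℝ × ℝ => p.1 * p.2) := by fun_prop
  have hjoint : Measure.map (fun ω => (G₁ ω, G₂ ω)) μ = (gammaDist r l).prod (gammaDist s l) := by
    rw [(indepFun_iff_map_prod_eq_prod_map_map hG₁.aemeasurable hG₂.aemeasurable).1 hindep,
      hG₁law, hG₂law]
  have hlaw : Measure.map Y μ
      = Measure.map (fun p : ℝ × ℝ => p.1 * p.2) ((gammaDist r l).prod (gammaDist s l)) := by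
    rw [← hjoint, Measure.map_map mmul (by fun_prop)]
    rfl
  have pmY : IsProbabilityMeasure (Measure.map Y μ) := Measure.isProbabilityMeasure_map hY.aemeasurable
  have pmW : IsProbabilityMeasure (Measure.map W ν) := Measure.isProbabilityMeasure_map hW.aemeasurable
  have H : ∀ (a b c : ℝ → ℝ) (K : ℝ), Measurable a → Measurable b → Measurable c →
      (∀ x > 0, HasDerivAt a (b x / x) x) → (∀ x > 0, HasDerivAt b (c x / x) x) →
      (∀ x, |a x| ≤ K) → (∀ x, |b x| ≤ K) → (∀ x, |c x| ≤ K) →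
      ∫ y, (c y + (r + s) * b y + (r * s - l ^ 2 * y) * a y) ∂(Measure.map Y μ) = 0 := by
    intro a b c K am bm cm ad bd aK bK cK
    rw [hlaw, integral_map mmul.aemeasurable
      (Measurable.aestronglyMeasurable (by fun_prop))]
    exact gg_core r s l hr hs hl a b c K am bm cm ad bd aK bK cK
  have hposω : ∀ᵐ ω ∂μ, 0 < Y ω := by
    have h1 : ∀ᵐ ω ∂μ, 0 < G₁ ω :=
      ae_of_ae_map hG₁.aemeasurable (hG₁law ▸ gg_gamma_pos r l)
    have h2 : ∀ᵐ ω ∂μ, 0 < G₂ ω :=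
      ae_of_ae_map hG₂.aemeasurable (hG₂law ▸ gg_gamma_pos s l)
    filter_upwards [h1, h2] with ω h1 h2 using mul_pos h1 h2
  have hposY : ∀ᵐ y ∂(Measure.map Y μ), 0 < y :=
    (ae_map_iff hY.aemeasurable measurableSet_Ioi).2 hposω
  have hmomY : ∀ n : ℕ, Integrable (fun ω => Y ω ^ n) μ := by
    intro n
    have h1 : Integrable (fun y : ℝ => y ^ n) (Measure.map Y μ) := by
      rw [hlaw, integrable_map_measure (Measurable.aestronglyMeasurable (by fun_prop))
        mmul.aemeasurable]
      have := (gg_gamma_moment r l hr hl n).mul_prod (gg_gamma_moment s l hs hl n)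
      refine this.congr (Eventually.of_forall fun p => ?_)
      simp [mul_pow]
    have hpm : AEStronglyMeasurable (fun y : ℝ => y ^ n) (Measure.map Y μ) :=
      Continuous.aestronglyMeasurable (by fun_prop)
    exact (integrable_map_measure hpm hY.aemeasurable).1 h1
  -- exponential test functions
  have hexpd : ∀ (t : ℝ) (n : ℕ), ∀ y > 0,
      iteratedDerivWithin n (fun y => Real.exp (-t * y)) (Ioi 0) y
        = (-t) ^ n * Real.exp (-t * y) := by
    intro t n y hy
    rw [iteratedDerivWithin_of_isOpen isOpen_Ioi (show y ∈ Ioi (0:ℝ) from hy),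
      iteratedDeriv_exp_const_mul]
  have hexpmem : ∀ t > 0, memFGG μ Y (fun y => Real.exp (-t * y)) := by
    intro t ht
    refine ⟨ContDiff.contDiffOn (by fun_prop), fun n _ j _ => ?_⟩
    have h1 : Integrable (fun ω => Y ω ^ j * ((-t) ^ n * Real.exp (-t * Y ω))) μ := by
      refine (hmomY j).mul_bdd (c := |t| ^ n)
        (Measurable.aestronglyMeasurable (by fun_prop)) ?_
      filter_upwards [hposω] with ω hω
      rw [norm_mul, norm_pow, norm_neg, Real.norm_eq_abs, Real.norm_eq_abs,
        abs_of_pos (Real.exp_pos _)]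
      refine mul_le_of_le_one_right (by positivity) ?_
      rw [Real.exp_le_one_iff]
      nlinarith [mul_pos ht hω]
    refine h1.congr ?_
    filter_upwards [hposω] with ω hω
    rw [hexpd t n _ hω]
  have hexpS : ∀ (t : ℝ), ∀ y > 0, steinGammaGamma r s l (fun y => Real.exp (-t * y)) y
      = (t ^ 2 * y ^ 2 - (1 + r + s) * t * y + (r * s - l ^ 2 * y)) * Real.exp (-t * y) := by
    intro t y hy
    have h1 := hexpd t 1 y hy
    rw [iteratedDerivWithin_one] at h1
    simp only [steinGammaGamma]
    rw [h1, hexpd t 2 y hy]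
    ring
  constructor
  · intro hWY f hf
    obtain ⟨T, Tm, hT, hT0⟩ := gg_stein_zero μ Y hY r s l hposY H f hf
    have hposW : ∀ᵐ ω ∂ν, 0 < W ω := ae_of_ae_map hW.aemeasurable (hWY ▸ hposY)
    rw [← hT0, ← hWY, integral_map hW.aemeasurable Tm.aestronglyMeasurable]
    refine integral_congr_ae ?_
    filter_upwards [hposW] with ω hω using hT _ hω
  · intro hstein
    have hW1 : Integrable W ν := by
      have h2 : MemLp W 2 ν := (memLp_two_iff_integrable_sq hW.aestronglyMeasurable).2 hWmom
      exact h2.integrable (by norm_num)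
    have hposW : ∀ᵐ ω ∂ν, 0 < W ω := by
      set f : ℝ → ℝ := Set.indicator (Iic (0:ℝ)) (fun _ => 1) with hf
      have f0 : EqOn f (fun _ => 0) (Ioi (0:ℝ)) := by
        intro y hy
        exact indicator_of_notMem (by simpa using hy) _
      have fd : ∀ n : ℕ, ∀ y > 0, iteratedDerivWithin n f (Ioi 0) y = 0 := by
        intro n y hy
        rw [iteratedDerivWithin_congr f0 (show y ∈ Ioi (0:ℝ) from hy)]
        simp [iteratedDerivWithin_const]
      have hm : memFGG μ Y f := by
        refine ⟨contDiffOn_const.congr f0, fun n _ j _ => ?_⟩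
        refine (integrable_zero Ω ℝ μ).congr ?_
        filter_upwards [hposω] with ω hω
        rw [fd n _ hω]
        simp
      have hS : ∀ y, steinGammaGamma r s l f y
          = Set.indicator (Iic (0:ℝ)) (fun y => r * s - l ^ 2 * y) y := by
        intro y
        rcases lt_trichotomy y 0 with hy | hy | hy
        · have hcl : y ∉ closure (Ioi (0:ℝ)) := by
            rw [closure_Ioi]; simpa using hy
          have hmem : y ∈ Iic (0:ℝ) := hy.le
          rw [steinGammaGamma, iteratedDerivWithin_succ, derivWithin_zero_of_notMem_closure hcl,
            derivWithin_zero_of_notMem_closure hcl, hf, indicator_of_mem hmem, indicator_of_mem hmem]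
          ring
        · subst hy
          have hmem : (0:ℝ) ∈ Iic (0:ℝ) := Set.mem_Iic.2 le_rfl
          rw [steinGammaGamma, hf, indicator_of_mem hmem, indicator_of_mem hmem]
          ring
        · have h1 := fd 1 y hy
          rw [iteratedDerivWithin_one] at h1
          rw [steinGammaGamma, fd 2 y hy, h1, f0 hy, indicator_of_notMem (by simpa using hy)]
          ring
      have h0 := hstein f hm
      simp_rw [hS] at h0
      have hnn : ∀ y : ℝ, 0 ≤ Set.indicator (Iic (0:ℝ)) (fun y => r * s - l ^ 2 * y) y := by
        intro y
        refine indicator_nonneg (fun y hy => ?_) y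
        have hy : y ≤ 0 := hy
        nlinarith [mul_pos hr hs, mul_nonneg (sq_nonneg l) (neg_nonneg.2 hy)]
      have hi : Integrable (fun ω => Set.indicator (Iic (0:ℝ)) (fun y => r * s - l ^ 2 * y) (W ω)) ν := by
        have h1 : Integrable (fun ω => r * s - l ^ 2 * W ω) ν :=
          (integrable_const _).sub (hW1.const_mul _)
        have h2 := h1.indicator (hW measurableSet_Iic : MeasurableSet (W ⁻¹' Iic 0))
        exact h2
      have h1 := (integral_eq_zero_iff_of_nonneg (fun ω => hnn (W ω)) hi).1 h0
      filter_upwards [h1] with ω hω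
      by_contra hneg
      have hmem : W ω ∈ Iic (0:ℝ) := not_lt.1 hneg
      rw [indicator_of_mem hmem] at hω
      have hy : W ω ≤ 0 := hmem
      simp only [Pi.zero_apply] at hω
      nlinarith [mul_pos hr hs, mul_nonneg (sq_nonneg l) (neg_nonneg.2 hy)]
    have hposW' : ∀ᵐ y ∂(Measure.map W ν), 0 < y :=
      (ae_map_iff hW.aemeasurable measurableSet_Ioi).2 hposW
    refine gg_law_unique (Measure.map W ν) (Measure.map Y μ) hposW' hposY ?_ ?_
      (1 + r + s) (l ^ 2) (r * s) (by positivity) (by positivity) (by positivity) ?_ ?_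
    · exact (integrable_map_measure (by fun_prop) hW.aemeasurable).2 hW1
    · refine (integrable_map_measure (by fun_prop) hY.aemeasurable).2 ?_
      simpa [Function.comp_def] using hmomY 1
    · intro t ht
      rw [integral_map hW.aemeasurable (Measurable.aestronglyMeasurable (by fun_prop)),
        ← hstein _ (hexpmem t ht)]
      refine integral_congr_ae ?_
      filter_upwards [hposW] with ω hω using (hexpS t _ hω).symm
    · intro t ht
      obtain ⟨T, Tm, hT, hT0⟩ := gg_stein_zero μ Y hY r s l hposY H _ (hexpmem t ht)
      rw [← hT0]
      refine integral_congr_ae ?_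
      filter_upwards [hposY] with y hy
      rw [← hT y hy, hexpS t y hy]
end

section
/- Let X be a standard Gaussian random variable and let Y = H₃(X) = X³ − 3X. Define the operator S₃' f(y) = 5y f(y) − (3y²+12) f'(y) + 207y f''(y) + (351y² − 1080) f^{(3)}(y) + (81y³ − 324y) f^{(4)}(y). Let W be a real-valued random variable with E[|W|³] < ∞. Then W is equal in law to H₃(X) if and only if E[S₃' f(W)] = 0 for all f ∈ F_{S₃',Y}. -/
open MeasureTheory ProbabilityTheory Filter Set
open scoped Topology

/-- The standard Gaussian distribution, with density `(2π)^(-1/2) exp(-x²/2)` on `ℝ`. -/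
noncomputable def stdGaussian : Measure ℝ :=
  volume.withDensity fun x =>
    ENNReal.ofReal ((Real.sqrt (2 * Real.pi))⁻¹ * Real.exp (-x ^ 2 / 2))

/-- The law of `H₃(X) = X³ - 3X` for `X` standard Gaussian. -/
noncomputable def lawH3 : Measure ℝ := Measure.map (fun x : ℝ => x ^ 3 - 3 * x) stdGaussian

/-- The Stein operator `S₃' f(y) = 5y f(y) - (3y²+12) f'(y) + 207y f''(y)
+ (351y² - 1080) f⁽³⁾(y) + (81y³ - 324y) f⁽⁴⁾(y)` for `H₃(X)`. -/
noncomputable def steinH3' (f : ℝ → ℝ) (y : ℝ) : ℝ :=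
  5 * y * f y - (3 * y ^ 2 + 12) * deriv f y + 207 * y * iteratedDeriv 2 f y
    + (351 * y ^ 2 - 1080) * iteratedDeriv 3 f y
    + (81 * y ^ 3 - 324 * y) * iteratedDeriv 4 f y

/-- Membership in the class `F_{S₃',Y}` (here `T = 4`, `m = 3`, `I = ℝ`). -/
def memFH3' (f : ℝ → ℝ) : Prop :=
  ContDiff ℝ 4 f ∧
    ∀ t ≤ 4, ∀ j ≤ 3, Integrable (fun y => y ^ j * iteratedDeriv t f y) lawH3

lemma aux_bound {f g : ℝ → ℝ} (hf : ∀ x, HasDerivAt f (g x) x) (h0 : f 0 = 0)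
    {B B' : ℝ → ℝ} (hB0 : 0 ≤ B 0) (hB : ∀ x, HasDerivAt B (B' x) x) {T : ℝ}
    (hg : ∀ x ∈ Icc 0 T, |g x| ≤ B' x) : ∀ x ∈ Icc 0 T, |f x| ≤ B x := by
  intro x hx
  refine image_norm_le_of_norm_deriv_right_le_deriv_boundary (f := f) (f' := g) (a := 0) (b := T)
    (fun y _ => (hf y).continuousAt.continuousWithinAt) (fun y _ => (hf y).hasDerivWithinAt)
    (by simpa [h0] using hB0) hB (fun y hy => hg y ⟨hy.1, hy.2.le⟩) hx

lemma aux_bounds {ψ p u : ℝ → ℝ} (h1 : ∀ x, HasDerivAt ψ (p x) x)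
    (h2 : ∀ x, HasDerivAt p (u x) x) (hψ : ψ 0 = 0) (hp : p 0 = 0)
    {T M l : ℝ} (hM : 0 ≤ M) (hl : 0 ≤ l)
    (hb : ∀ s ∈ Icc 0 T, |u s| ≤ M * (s * Real.exp (l * s))) :
    (∀ s ∈ Icc 0 T, |p s| ≤ M * (s ^ 2 * Real.exp (l * s) / 2)) ∧
    (∀ s ∈ Icc 0 T, |ψ s| ≤ M * (s ^ 3 * Real.exp (l * s) / 6)) := by
  have hexp : ∀ x : ℝ, HasDerivAt (fun s => Real.exp (l * s)) (Real.exp (l * x) * l) x := by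
    intro x
    simpa using ((hasDerivAt_id x).const_mul l).exp
  have hA : ∀ s ∈ Icc 0 T, |p s| ≤ M * (s ^ 2 * Real.exp (l * s) / 2) := by
    refine aux_bound h2 hp (B := fun s => M * (s ^ 2 * Real.exp (l * s) / 2)) (by simp)
      (fun x => ((((hasDerivAt_id x).pow 2).mul (hexp x)).div_const 2).const_mul M) ?_
    intro x hx
    refine (hb x hx).trans (mul_le_mul_of_nonneg_left ?_ hM)
    have := (Real.exp_pos (l * x)).le
    have h3 : 0 ≤ x ^ 2 * (Real.exp (l * x) * l) := by positivity
    simp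
    nlinarith
  refine ⟨hA, ?_⟩
  refine aux_bound h1 hψ (B := fun s => M * (s ^ 3 * Real.exp (l * s) / 6)) (by simp)
      (fun x => ((((hasDerivAt_id x).pow 3).mul (hexp x)).div_const 6).const_mul M) ?_
  intro x hx
  refine (hA x hx).trans (mul_le_mul_of_nonneg_left ?_ hM)
  have := (Real.exp_pos (l * x)).le
  have hx0 := hx.1
  have h3 : 0 ≤ x ^ 3 * (Real.exp (l * x) * l) := by positivity
  simp
  nlinarith

lemma aux_max {ψ p u w : ℝ → ℝ} (h1 : ∀ x, HasDerivAt ψ (p x) x)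
    (h2 : ∀ x, HasDerivAt p (u x) x) (h3 : ∀ x, HasDerivAt u (w x) x)
    (hψ : ψ 0 = 0) (hp : p 0 = 0)
    (hode : ∀ x, 81 * x ^ 4 * w x + (351 * x ^ 3 + 3 * x) * u x
      + (324 * x ^ 4 + 207 * x ^ 2 - 5) * p x + (1080 * x ^ 3 - 12 * x) * ψ x = 0)
    {T M c : ℝ} (hM : 0 < M) (hc0 : 0 < c) (hcT : c ≤ T)
    (hb : ∀ s ∈ Icc 0 T, |u s| ≤ M * (s * Real.exp (5 * T * s)))
    (hc : u c = M * (c * Real.exp (5 * T * c))) : False := by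
  have hT : 0 < T := hc0.trans_le hcT
  obtain ⟨bp, bψ⟩ := aux_bounds h1 h2 hψ hp hM.le (by positivity : 0 ≤ 5 * T) hb
  have hcm : c ∈ Icc 0 T := ⟨hc0.le, hcT⟩
  replace bp := bp c hcm
  replace bψ := bψ c hcm
  set e := Real.exp (5 * T * c) with he
  have hepos : 0 < e := Real.exp_pos _
  have hexp : HasDerivAt (fun s => Real.exp (5 * T * s)) (e * (5 * T)) c := by
    simpa using ((hasDerivAt_id c).const_mul (5 * T)).exp
  -- difference is maximal at c
  have hd : HasDerivAt (fun s => u s - M * (s * Real.exp (5 * T * s)))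
      (w c - M * (1 * e + c * (e * (5 * T)))) c :=
    (h3 c).sub (((hasDerivAt_id c).mul hexp).const_mul M)
  have hw : 0 ≤ w c - M * (1 * e + c * (e * (5 * T))) := by
    have ht := (hasDerivWithinAt_iff_tendsto_slope' (s := Iio c) (by simp)).1
      (hd.hasDerivWithinAt (s := Iio c))
    refine ge_of_tendsto ht ?_
    have : Ioo 0 c ∈ 𝓝[<] c := Ioo_mem_nhdsLT hc0
    filter_upwards [this] with s hs
    rw [slope_def_field]
    have := (le_abs_self _).trans (hb s ⟨hs.1.le, hs.2.le.trans hcT⟩)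
    apply div_nonneg_of_nonpos
    · rw [hc]; simp only [← he]; linarith
    · linarith [hs.2]
  have ode := hode c
  rw [hc] at ode
  have e1 := abs_le.1 bp
  have e2 := abs_le.1 bψ
  have k1 : 81 * c ^ 4 * (M * (1 * e + c * (e * (5 * T)))) ≤ 81 * c ^ 4 * w c := by
    apply mul_le_mul_of_nonneg_left _ (by positivity); linarith
  have k2 : -((324 * c ^ 4 + 207 * c ^ 2) * (M * (c ^ 2 * e / 2)))
      ≤ (324 * c ^ 4 + 207 * c ^ 2) * p c := by
    rw [← mul_neg]; exact mul_le_mul_of_nonneg_left e1.1 (by positivity)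
  have k3 : -(1080 * c ^ 3 * (M * (c ^ 3 * e / 6))) ≤ 1080 * c ^ 3 * ψ c := by
    rw [← mul_neg]; exact mul_le_mul_of_nonneg_left e2.1 (by positivity)
  have k4 : 12 * c * ψ c ≤ 12 * c * (M * (c ^ 3 * e / 6)) :=
    mul_le_mul_of_nonneg_left e2.2 (by positivity)
  have k5 : 5 * p c ≤ 5 * (M * (c ^ 2 * e / 2)) := by linarith [e1.2]
  have key : M * e * c ^ 2 * (1 / 2 + (81 + 351 - 105.5) * c ^ 2 + 405 * c ^ 3 * T - 342 * c ^ 4) ≤ 0 := by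
    nlinarith
  have k6 : c ^ 4 ≤ c ^ 3 * T := by
    have : 0 ≤ c ^ 3 * (T - c) := mul_nonneg (by positivity) (by linarith)
    nlinarith
  have : 0 < M * e * c ^ 2 * (1 / 2 + (81 + 351 - 105.5) * c ^ 2 + 405 * c ^ 3 * T - 342 * c ^ 4) := by
    apply mul_pos (by positivity)
    have : 0 ≤ c ^ 2 := by positivity
    have : 0 ≤ c ^ 4 := by positivity
    norm_num
    nlinarith
  linarith

lemma aux_uniq {ψ p u w : ℝ → ℝ} (h1 : ∀ x, HasDerivAt ψ (p x) x)
    (h2 : ∀ x, HasDerivAt p (u x) x) (h3 : ∀ x, HasDerivAt u (w x) x)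
    (hψ : ψ 0 = 0) (hp : p 0 = 0) (hu : u 0 = 0) (hw : w 0 = 0)
    (hode : ∀ x, 81 * x ^ 4 * w x + (351 * x ^ 3 + 3 * x) * u x
      + (324 * x ^ 4 + 207 * x ^ 2 - 5) * p x + (1080 * x ^ 3 - 12 * x) * ψ x = 0)
    (T : ℝ) (hT : 0 ≤ T) : ψ T = 0 := by
  have hcont : Continuous (fun s => |dslope u 0 s * Real.exp (-(5 * T * s))|) := by
    have : Continuous (dslope u 0) := by
      rw [continuous_iff_continuousAt]
      intro x
      by_cases hx : x = 0
      · subst hx; exact continuousAt_dslope_same.2 (h3 0).differentiableAt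
      · exact (continuousAt_dslope_of_ne hx).2 (h3 x).continuousAt
    fun_prop
  obtain ⟨c, hc, hmax⟩ := isCompact_Icc.exists_isMaxOn (nonempty_Icc.2 hT) hcont.continuousOn
  have hval : ∀ s, u s = dslope u 0 s * Real.exp (-(5 * T * s)) * (s * Real.exp (5 * T * s)) := by
    intro s
    have h5 : Real.exp (-(5 * T * s)) * Real.exp (5 * T * s) = 1 := by
      rw [← Real.exp_add]; simp
    have h6 : s * dslope u 0 s = u s := by
      have := sub_smul_dslope u 0 s
      simpa [hu] using this
    calc u s = s * dslope u 0 s * 1 := by rw [h6]; ring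
      _ = _ := by rw [← h5]; ring
  set v := fun s => dslope u 0 s * Real.exp (-(5 * T * s)) with hv
  have hb : ∀ s ∈ Icc 0 T, |u s| ≤ |v c| * (s * Real.exp (5 * T * s)) := by
    intro s hs
    have hs0 := hs.1
    have h7 : 0 ≤ s * Real.exp (5 * T * s) := by positivity
    rw [hval s, abs_mul, abs_of_nonneg h7]
    exact mul_le_mul_of_nonneg_right (hmax hs) h7
  have hM0 : |v c| = 0 := by
    by_contra hne
    have hMpos : 0 < |v c| := lt_of_le_of_ne (abs_nonneg _) (Ne.symm hne)
    have hc0 : 0 < c := by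
      rcases hc.1.eq_or_lt with h | h
      · exfalso; apply hne
        rw [← h]; simp [hv, dslope_same, (h3 0).deriv, hw]
      · exact h
    rcases le_total 0 (v c) with h | h
    · refine aux_max h1 h2 h3 hψ hp hode hMpos hc0 hc.2 hb ?_
      rw [abs_of_nonneg h]; exact hval c
    · refine aux_max (ψ := fun x => -ψ x) (p := fun x => - p x) (u := fun x => - u x)
        (w := fun x => - w x) (fun x => (h1 x).neg) (fun x => (h2 x).neg) (fun x => (h3 x).neg)
        (by simp [hψ]) (by simp [hp]) (fun x => by linear_combination -hode x)
        hMpos hc0 hc.2 (by simpa using hb) ?_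
      rw [abs_of_nonpos h]; rw [hval c]; ring
  rw [hM0] at hb
  have := (aux_bounds h1 h2 hψ hp le_rfl (by positivity : 0 ≤ 5 * T) hb).2 T ⟨hT, le_rfl⟩
  simpa using this

lemma stdGaussian_eq : _root_.stdGaussian = gaussianReal 0 1 := by
  rw [gaussianReal_of_var_ne_zero _ one_ne_zero, _root_.stdGaussian]
  congr 1
  ext x
  simp [gaussianPDF, gaussianPDFReal]

lemma h3_meas : Measurable (fun x : ℝ => x ^ 3 - 3 * x) := by fun_prop

lemma lawH3_prob : IsProbabilityMeasure lawH3 := by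
  unfold lawH3
  rw [stdGaussian_eq]
  exact Measure.isProbabilityMeasure_map h3_meas.aemeasurable

lemma gauss_mom (n : ℕ) : Integrable (fun x : ℝ => |x| ^ n) _root_.stdGaussian := by
  rw [stdGaussian_eq]
  have h := memLp_id_gaussianReal (μ := 0) (v := 1) n
  simpa using h.integrable_norm_pow'

lemma gauss_mom' (n : ℕ) : Integrable (fun x : ℝ => x ^ n) _root_.stdGaussian := by
  refine (gauss_mom n).mono (by fun_prop) (ae_of_all _ fun x => ?_)
  simp

lemma lawH3_mom (n : ℕ) : Integrable (fun y : ℝ => y ^ n) lawH3 := by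
  unfold lawH3
  rw [integrable_map_measure (by fun_prop) h3_meas.aemeasurable]
  have hb : Integrable (fun x : ℝ => (2 : ℝ) ^ (n - 1) * ((|x| ^ (3 * n)) + 3 ^ n * |x| ^ n)) _root_.stdGaussian :=
    ((gauss_mom _).add ((gauss_mom n).const_mul _)).const_mul _
  refine hb.mono (by fun_prop) (ae_of_all _ fun x => ?_)
  simp only [Function.comp_apply, norm_pow]
  have h1 : ‖x ^ 3 - 3 * x‖ ≤ |x| ^ 3 + 3 * |x| := by
    refine (norm_sub_le _ _).trans (le_of_eq ?_)
    simp
  calc ‖x ^ 3 - 3 * x‖ ^ n ≤ (|x| ^ 3 + 3 * |x|) ^ n := pow_le_pow_left₀ (norm_nonneg _) h1 n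
    _ ≤ 2 ^ (n - 1) * ((|x| ^ 3) ^ n + (3 * |x|) ^ n) :=
      add_pow_le (by positivity) (by positivity) n
    _ = 2 ^ (n - 1) * (|x| ^ (3 * n) + 3 ^ n * |x| ^ n) := by rw [← pow_mul, mul_pow]
    _ ≤ _ := le_abs_self _

/-- Density. -/
noncomputable def rho (x : ℝ) : ℝ := (Real.sqrt (2 * Real.pi))⁻¹ * Real.exp (-x ^ 2 / 2)

lemma rho_nonneg (x : ℝ) : 0 ≤ rho x := by unfold rho; positivity

lemma rho_cont : Continuous rho := by unfold rho; fun_prop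

lemma rho_deriv (x : ℝ) : HasDerivAt rho (-x * rho x) x := by
  have h : HasDerivAt (fun y : ℝ => -y ^ 2 / 2) (-x) x := by
    have := (((hasDerivAt_id x).pow 2).neg).div_const 2
    refine (this.congr_deriv ?_)
    simp; ring
  refine ((h.exp).const_mul (Real.sqrt (2 * Real.pi))⁻¹).congr_deriv ?_
  unfold rho; ring

lemma stdG_int_iff (g : ℝ → ℝ) :
    Integrable g _root_.stdGaussian ↔ Integrable (fun x => rho x * g x) volume := by
  unfold _root_.stdGaussian
  rw [integrable_withDensity_iff_integrable_smul' (by fun_prop) (ae_of_all _ fun x => ENNReal.ofReal_lt_top)]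
  refine integrable_congr (ae_of_all _ fun x => ?_)
  simp only [smul_eq_mul]
  rw [← rho, ENNReal.toReal_ofReal (rho_nonneg x)]

lemma stdG_integral (g : ℝ → ℝ) :
    ∫ x, g x ∂_root_.stdGaussian = ∫ x, rho x * g x := by
  unfold _root_.stdGaussian
  rw [integral_withDensity_eq_integral_toReal_smul (by fun_prop) (ae_of_all _ fun x => ENNReal.ofReal_lt_top)]
  refine integral_congr_ae (ae_of_all _ fun x => ?_)
  simp only [smul_eq_mul]
  rw [← rho, ENNReal.toReal_ofReal (rho_nonneg x)]

lemma pow_bound (x : ℝ) (k : ℕ) (hk : k ≤ 9) : |x| ^ k ≤ (2 * |x ^ 3 - 3 * x| + 27) ^ 3 := by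
  have h1 : (max 1 |x|) ^ 3 ≤ 2 * |x ^ 3 - 3 * x| + 27 := by
    have ha := abs_nonneg (x ^ 3 - 3 * x)
    rcases le_total |x| 3 with h | h
    · have : (max 1 |x|) ^ 3 ≤ 3 ^ 3 := pow_le_pow_left₀ (by positivity) (max_le (by norm_num) h) 3
      linarith
    · rw [max_eq_right (by linarith)]
      have : |x| ^ 3 - 3 * |x| ≤ |x ^ 3 - 3 * x| := by
        have := abs_sub_abs_le_abs_sub (x ^ 3) (3 * x)
        simpa [abs_mul, abs_pow] using this
      nlinarith [mul_nonneg (abs_nonneg x) (sub_nonneg.2 h), sq_nonneg (|x|), mul_nonneg (mul_nonneg (abs_nonneg x) (abs_nonneg x)) (sub_nonneg.2 h)]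
  calc |x| ^ k ≤ (max 1 |x|) ^ k := pow_le_pow_left₀ (abs_nonneg _) (le_max_right _ _) k
    _ ≤ (max 1 |x|) ^ 9 := pow_le_pow_right₀ (le_max_left _ _) hk
    _ = ((max 1 |x|) ^ 3) ^ 3 := by rw [← pow_mul]
    _ ≤ _ := pow_le_pow_left₀ (by positivity) h1 3

lemma int_pow_comp {F : ℝ → ℝ} (hF : Continuous F)
    (hi : ∀ j ≤ 3, Integrable (fun y => y ^ j * F y) lawH3) (k : ℕ) (hk : k ≤ 9) :
    Integrable (fun x => rho x * (x ^ k * F (x ^ 3 - 3 * x))) volume := by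
  rw [← stdG_int_iff (fun x => x ^ k * F (x ^ 3 - 3 * x))]
  have hj : ∀ j ≤ 3, Integrable (fun x : ℝ => |x ^ 3 - 3 * x| ^ j * |F (x ^ 3 - 3 * x)|) _root_.stdGaussian := by
    intro j hj
    have := hi j hj
    unfold lawH3 at this
    rw [integrable_map_measure (by fun_prop) h3_meas.aemeasurable] at this
    simpa [Function.comp_def, abs_mul, abs_pow] using this.abs
  have hb : Integrable (fun x : ℝ => (2 * |x ^ 3 - 3 * x| + 27) ^ 3 * |F (x ^ 3 - 3 * x)|) _root_.stdGaussian := by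
    have := (((hj 3 le_rfl).const_mul 8).add ((hj 2 (by norm_num)).const_mul (3 * 4 * 27))).add
      (((hj 1 (by norm_num)).const_mul (3 * 2 * 27 ^ 2)).add ((hj 0 (by norm_num)).const_mul (27 ^ 3)))
    refine this.congr (ae_of_all _ fun x => ?_)
    simp only [Pi.add_apply]
    ring
  refine hb.mono (by fun_prop) (ae_of_all _ fun x => ?_)
  rw [Real.norm_eq_abs, Real.norm_eq_abs, abs_mul, abs_mul, abs_abs, abs_pow]
  exact mul_le_mul_of_nonneg_right ((pow_bound x k hk).trans (le_abs_self _)) (abs_nonneg _)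

lemma lawH3_stein (f : ℝ → ℝ) (hf : memFH3' f) : ∫ y, steinH3' f y ∂lawH3 = 0 := by
  obtain ⟨hC, hI⟩ := hf
  have hcont : ∀ t ≤ 4, Continuous (iteratedDeriv t f) := fun t ht =>
    hC.continuous_iteratedDeriv t (by exact_mod_cast ht)
  have hder : ∀ t < 4, ∀ y, HasDerivAt (iteratedDeriv t f) (iteratedDeriv (t + 1) f y) y := by
    intro t ht y
    rw [iteratedDeriv_succ]
    exact ((hC.differentiable_iteratedDeriv t (by exact_mod_cast ht)) y).hasDerivAt
  have hS : Continuous (steinH3' f) := by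
    unfold steinH3'
    have c0 := hcont 0 (by norm_num)
    have c1 := hcont 1 (by norm_num)
    have c2 := hcont 2 (by norm_num)
    have c3 := hcont 3 (by norm_num)
    have c4 := hcont 4 (by norm_num)
    rw [iteratedDeriv_zero] at c0
    rw [iteratedDeriv_one] at c1
    fun_prop
  unfold lawH3
  rw [integral_map h3_meas.aemeasurable hS.aestronglyMeasurable, stdG_integral]
  have I : ∀ t ≤ 4, ∀ k ≤ 9,
      Integrable (fun x => rho x * (x ^ k * iteratedDeriv t f (x ^ 3 - 3 * x))) volume :=
    fun t ht k hk => int_pow_comp (hcont t ht) (hI t ht) k hk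
  have hh : ∀ x : ℝ, HasDerivAt (fun x : ℝ => x ^ 3 - 3 * x) (3 * x ^ 2 - 3) x := by
    intro x
    refine ((hasDerivAt_pow 3 x).sub ((hasDerivAt_id x).const_mul 3)).congr_deriv ?_
    simp
  have hcomp : ∀ t < 4, ∀ x, HasDerivAt (fun x : ℝ => iteratedDeriv t f (x ^ 3 - 3 * x))
      (iteratedDeriv (t + 1) f (x ^ 3 - 3 * x) * (3 * x ^ 2 - 3)) x := fun t ht x =>
    (hder t ht _).comp x (hh x)
  have hpoly : ∀ (k : ℕ) (x : ℝ), HasDerivAt (fun x : ℝ => x ^ k) (k * x ^ (k - 1)) x :=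
    fun k x => hasDerivAt_pow k x
  refine integral_eq_zero_of_hasDerivAt_of_integrable
    (f := fun x => rho x * ((5 - 5 * x ^ 2) * iteratedDeriv 0 f (x ^ 3 - 3 * x)
      + (3 * x ^ 5 - 18 * x ^ 3 + 3 * x ^ 1) * iteratedDeriv 1 f (x ^ 3 - 3 * x)
      + (9 * x ^ 6 - 9 * x ^ 4 - 180 * x ^ 2 + 252) * iteratedDeriv 2 f (x ^ 3 - 3 * x)
      + (27 * x ^ 7 - 216 * x ^ 5 + 513 * x ^ 3 - 324 * x ^ 1)
        * iteratedDeriv 3 f (x ^ 3 - 3 * x))) ?_ ?_ ?_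
  · intro x
    have d0 := (((hpoly 2 x).const_mul 5).const_sub 5).mul (hcomp 0 (by norm_num) x)
    have d1 := ((((hpoly 5 x).const_mul 3).sub ((hpoly 3 x).const_mul 18)).add
      ((hpoly 1 x).const_mul 3)).mul (hcomp 1 (by norm_num) x)
    have d2 := (((((hpoly 6 x).const_mul 9).sub ((hpoly 4 x).const_mul 9)).sub
      ((hpoly 2 x).const_mul 180)).add_const 252).mul (hcomp 2 (by norm_num) x)
    have d3 := (((((hpoly 7 x).const_mul 27).sub ((hpoly 5 x).const_mul 216)).add
      ((hpoly 3 x).const_mul 513)).sub ((hpoly 1 x).const_mul 324)).mul (hcomp 3 (by norm_num) x)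
    refine ((rho_deriv x).mul (((d0.add d1).add d2).add d3)).congr_deriv ?_
    simp only [steinH3', Pi.add_apply, Pi.mul_apply, Pi.sub_apply, iteratedDeriv_zero, iteratedDeriv_one, Nat.reduceAdd, Nat.reduceSub]
    push_cast
    generalize iteratedDeriv 4 f (x ^ 3 - 3 * x) = f4
    generalize iteratedDeriv 3 f (x ^ 3 - 3 * x) = f3
    generalize iteratedDeriv 2 f (x ^ 3 - 3 * x) = f2
    generalize deriv f (x ^ 3 - 3 * x) = f1
    generalize f (x ^ 3 - 3 * x) = f0
    ring
  · have J := fun (t : ℕ) (ht : t ≤ 4) (a b c d : ℝ) => ((((I t ht 9 (by norm_num)).const_mul a).add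
      ((I t ht 7 (by norm_num)).const_mul b)).add ((I t ht 5 (by norm_num)).const_mul c)).add
      (((I t ht 3 (by norm_num)).const_mul d))
    have K := fun (t : ℕ) (ht : t ≤ 4) (a b c d : ℝ) => ((((I t ht 6 (by norm_num)).const_mul a).add
      ((I t ht 4 (by norm_num)).const_mul b)).add ((I t ht 2 (by norm_num)).const_mul c)).add
      (((I t ht 0 (by norm_num)).const_mul d))
    have T0 := ((J 0 (by norm_num) 0 0 0 5).add ((I 0 (by norm_num) 1 (by norm_num)).const_mul (-15)))
    have T1 := K 1 (by norm_num) (-3) 18 (-27) (-12)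
    have T2 := ((J 2 (by norm_num) 0 0 0 207).add ((I 2 (by norm_num) 1 (by norm_num)).const_mul (-621)))
    have T3 := K 3 (by norm_num) 351 (-2106) 3159 (-1080)
    have T4 := ((J 4 (by norm_num) 81 (-729) 2187 (-2187 - 324)).add ((I 4 (by norm_num) 1 (by norm_num)).const_mul 972))
    refine ((((T0.add T1).add T2).add T3).add T4).congr (ae_of_all _ fun x => ?_)
    simp only [steinH3', Pi.add_apply, iteratedDeriv_zero, iteratedDeriv_one]
    generalize iteratedDeriv 4 f (x ^ 3 - 3 * x) = f4
    generalize iteratedDeriv 3 f (x ^ 3 - 3 * x) = f3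
    generalize iteratedDeriv 2 f (x ^ 3 - 3 * x) = f2
    generalize deriv f (x ^ 3 - 3 * x) = f1
    generalize f (x ^ 3 - 3 * x) = f0
    ring
  · have J := fun (t : ℕ) (ht : t ≤ 4) (a b c d : ℝ) => ((((I t ht 7 (by norm_num)).const_mul a).add
      ((I t ht 5 (by norm_num)).const_mul b)).add ((I t ht 3 (by norm_num)).const_mul c)).add
      (((I t ht 1 (by norm_num)).const_mul d))
    have K := fun (t : ℕ) (ht : t ≤ 4) (a b c d : ℝ) => ((((I t ht 6 (by norm_num)).const_mul a).add
      ((I t ht 4 (by norm_num)).const_mul b)).add ((I t ht 2 (by norm_num)).const_mul c)).add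
      (((I t ht 0 (by norm_num)).const_mul d))
    have T0 := K 0 (by norm_num) 0 0 (-5) 5
    have T1 := J 1 (by norm_num) 0 3 (-18) 3
    have T2 := K 2 (by norm_num) 9 (-9) (-180) 252
    have T3 := J 3 (by norm_num) 27 (-216) 513 (-324)
    refine (((T0.add T1).add T2).add T3).congr (ae_of_all _ fun x => ?_)
    simp only [Pi.add_apply]
    generalize iteratedDeriv 3 f (x ^ 3 - 3 * x) = f3
    generalize iteratedDeriv 2 f (x ^ 3 - 3 * x) = f2
    generalize iteratedDeriv 1 f (x ^ 3 - 3 * x) = f1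
    generalize iteratedDeriv 0 f (x ^ 3 - 3 * x) = f0
    ring

lemma stein_cont {f : ℝ → ℝ} (hC : ContDiff ℝ 4 f) : Continuous (steinH3' f) := by
  have hcont : ∀ t ≤ 4, Continuous (iteratedDeriv t f) := fun t ht =>
    hC.continuous_iteratedDeriv t (by exact_mod_cast ht)
  unfold steinH3'
  have c0 := hcont 0 (by norm_num)
  have c1 := hcont 1 (by norm_num)
  have c2 := hcont 2 (by norm_num)
  have c3 := hcont 3 (by norm_num)
  have c4 := hcont 4 (by norm_num)
  rw [iteratedDeriv_zero] at c0
  rw [iteratedDeriv_one] at c1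
  fun_prop

/-- Trigonometric moments. -/
noncomputable def GG (μ : Measure ℝ) (k : ℕ) (θ ξ : ℝ) : ℝ := ∫ y, y ^ k * Real.sin (ξ * y + θ) ∂μ

lemma GG_int {μ : Measure ℝ} {k : ℕ} (hk : Integrable (fun y : ℝ => y ^ k) μ) (θ ξ : ℝ) :
    Integrable (fun y : ℝ => y ^ k * Real.sin (ξ * y + θ)) μ := by
  refine hk.mono (by fun_prop) (ae_of_all _ fun y => ?_)
  rw [norm_mul]
  exact mul_le_of_le_one_right (norm_nonneg _) (Real.abs_sin_le_one _)

lemma GG_deriv {μ : Measure ℝ} {k : ℕ} (hk : Integrable (fun y : ℝ => y ^ k) μ)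
    (hk1 : Integrable (fun y : ℝ => y ^ (k + 1)) μ) (θ ξ : ℝ) :
    HasDerivAt (GG μ k θ) (GG μ (k + 1) (θ + Real.pi / 2) ξ) ξ := by
  unfold GG
  refine (hasDerivAt_integral_of_dominated_loc_of_deriv_le (s := univ)
    (bound := fun y => |y ^ (k + 1)|)
    (F := fun ξ y => y ^ k * Real.sin (ξ * y + θ))
    (F' := fun ξ y => y ^ (k + 1) * Real.sin (ξ * y + (θ + Real.pi / 2)))
    univ_mem (Eventually.of_forall fun x => ?_) (GG_int hk θ ξ) ?_
    (ae_of_all _ fun y x _ => ?_) hk1.abs (ae_of_all _ fun y x _ => ?_)).2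
  · exact (GG_int hk θ x).aestronglyMeasurable
  · exact (GG_int hk1 _ ξ).aestronglyMeasurable
  · rw [norm_mul]
    exact mul_le_of_le_one_right (norm_nonneg _) (Real.abs_sin_le_one _)
  · have h : HasDerivAt (fun x : ℝ => x * y + θ) y x := by
      simpa using ((hasDerivAt_id x).mul_const y).add_const θ
    refine ((h.sin).const_mul (y ^ k)).congr_deriv ?_
    rw [← add_assoc, Real.sin_add_pi_div_two]
    ring

lemma iter_sin (ξ c : ℝ) (t : ℕ) : iteratedDeriv t (fun y : ℝ => Real.sin (ξ * y + c)) =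
    fun y => ξ ^ t * Real.sin (ξ * y + c + t * (Real.pi / 2)) := by
  induction t with
  | zero => simp
  | succ n ih =>
    rw [iteratedDeriv_succ, ih]
    ext y
    have h : HasDerivAt (fun y : ℝ => ξ * y + c + n * (Real.pi / 2)) ξ y := by
      simpa using (((hasDerivAt_id y).const_mul ξ).add_const c).add_const (n * (Real.pi / 2))
    rw [((h.sin).const_mul (ξ ^ n)).deriv]
    have : ξ * y + c + ((n + 1 : ℕ) : ℝ) * (Real.pi / 2)
      = ξ * y + c + n * (Real.pi / 2) + Real.pi / 2 := by push_cast; ring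
    rw [this, Real.sin_add_pi_div_two]
    ring

lemma sin_memF (ξ c : ℝ) : memFH3' (fun y : ℝ => Real.sin (ξ * y + c)) := by
  refine ⟨by fun_prop, fun t _ j _ => ?_⟩
  rw [iter_sin]
  have := (GG_int (lawH3_mom j) (c + t * (Real.pi / 2)) ξ).const_mul (ξ ^ t)
  refine this.congr (ae_of_all _ fun y => ?_)
  simp only [add_assoc]
  ring

/-- Good measures. -/
structure Good (μ : Measure ℝ) : Prop where
  prob : IsProbabilityMeasure μ
  mom : ∀ k ≤ 3, Integrable (fun y : ℝ => y ^ k) μ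
  stein : ∀ f, memFH3' f → ∫ y, steinH3' f y ∂μ = 0

lemma Good.ode {μ : Measure ℝ} (h : Good μ) (θ x : ℝ) :
    81 * x ^ 4 * GG μ 3 (θ + Real.pi / 2 + Real.pi / 2 + Real.pi / 2) x
      + (351 * x ^ 3 + 3 * x) * GG μ 2 (θ + Real.pi / 2 + Real.pi / 2) x
      + (324 * x ^ 4 + 207 * x ^ 2 - 5) * GG μ 1 (θ + Real.pi / 2) x
      + (1080 * x ^ 3 - 12 * x) * GG μ 0 θ x = 0 := by
  have hs := h.stein _ (sin_memF x (θ + Real.pi / 2))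
  have i0 := (GG_int (h.mom 0 (by norm_num)) θ x).const_mul (1080 * x ^ 3 - 12 * x)
  have i1 := (GG_int (h.mom 1 (by norm_num)) (θ + Real.pi / 2) x).const_mul
    (324 * x ^ 4 + 207 * x ^ 2 - 5)
  have i2 := (GG_int (h.mom 2 (by norm_num)) (θ + Real.pi / 2 + Real.pi / 2) x).const_mul
    (351 * x ^ 3 + 3 * x)
  have i3 := (GG_int (h.mom 3 (by norm_num))
    (θ + Real.pi / 2 + Real.pi / 2 + Real.pi / 2) x).const_mul (81 * x ^ 4)
  unfold GG
  rw [← integral_const_mul, ← integral_const_mul, ← integral_const_mul, ← integral_const_mul,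
    ← integral_add' i3 i2, ← integral_add' (i3.add i2) i1, ← integral_add' ((i3.add i2).add i1) i0,
    ← neg_eq_zero, ← integral_neg, ← hs]
  refine integral_congr_ae (ae_of_all _ fun y => ?_)
  simp only [steinH3', ← iteratedDeriv_one, iter_sin, Pi.add_apply]
  push_cast
  have e : ∀ n : ℝ, x * y + (θ + Real.pi / 2) + n * (Real.pi / 2) =
    x * y + θ + (n + 1) * (Real.pi / 2) := fun n => by ring
  have s1 : Real.sin (x * y + (θ + Real.pi / 2)) = Real.cos (x * y + θ) := by
    rw [← add_assoc, Real.sin_add_pi_div_two]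
  have s2 : Real.sin (x * y + (θ + Real.pi / 2 + Real.pi / 2)) = - Real.sin (x * y + θ) := by
    rw [← add_assoc, ← add_assoc, Real.sin_add_pi_div_two, Real.cos_add_pi_div_two]
  have s3 : Real.sin (x * y + (θ + Real.pi / 2 + Real.pi / 2 + Real.pi / 2))
      = - Real.cos (x * y + θ) := by
    rw [← add_assoc, ← add_assoc, ← add_assoc, Real.sin_add_pi_div_two, Real.cos_add_pi_div_two,
      Real.sin_add_pi_div_two]
  have t1 : Real.sin (x * y + (θ + Real.pi / 2) + 1 * (Real.pi / 2)) = - Real.sin (x * y + θ) := by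
    rw [← s2]; congr 1; ring
  have t2 : Real.sin (x * y + (θ + Real.pi / 2) + 2 * (Real.pi / 2)) = - Real.cos (x * y + θ) := by
    rw [← s3]; congr 1; ring
  have t3 : Real.sin (x * y + (θ + Real.pi / 2) + 3 * (Real.pi / 2)) = Real.sin (x * y + θ) := by
    rw [← Real.sin_add_two_pi (x * y + θ)]; congr 1; ring
  have t4 : Real.sin (x * y + (θ + Real.pi / 2) + 4 * (Real.pi / 2)) = Real.cos (x * y + θ) := by
    rw [← s1, ← Real.sin_add_two_pi (x * y + (θ + Real.pi / 2))]; congr 1; ring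
  rw [t1, t2, t3, t4, s1, s2, s3]
  ring

lemma iter_pow1 (n : ℕ) : iteratedDeriv n (fun y : ℝ => y ^ 1) =
    fun y => if n = 0 then y else if n = 1 then 1 else 0 := by
  rcases n with _ | _ | n
  · ext y; simp
  · ext y; simp
  · have : deriv (deriv (fun y : ℝ => y ^ 1)) = fun _ => 0 := by
      ext y; simp
    rw [iteratedDeriv_succ', iteratedDeriv_succ', this]
    ext y; simp

lemma iter_pow2 (n : ℕ) : iteratedDeriv n (fun y : ℝ => y ^ 2) =
    fun y => if n = 0 then y ^ 2 else if n = 1 then 2 * y else if n = 2 then 2 else 0 := by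
  have d1 : deriv (fun y : ℝ => y ^ 2) = fun y => 2 * y := by ext y; simp
  have d2 : deriv (fun y : ℝ => 2 * y) = fun _ => 2 := by
    ext y; simpa using ((hasDerivAt_id y).const_mul 2).deriv
  have d3 : deriv (fun _ : ℝ => (2 : ℝ)) = fun _ => 0 := by ext y; simp
  rcases n with _ | _ | _ | n
  · ext y; simp
  · ext y; simp
  · rw [iteratedDeriv_succ', iteratedDeriv_succ', d1, d2]
    ext y; simp
  · rw [iteratedDeriv_succ', iteratedDeriv_succ', iteratedDeriv_succ', d1, d2, d3]
    ext y; simp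

lemma Good.m0 {μ : Measure ℝ} (h : Good μ) : ∫ y, y ^ 0 ∂μ = 1 := by
  have := h.prob; simp

lemma Good.m1 {μ : Measure ℝ} (h : Good μ) : ∫ y, y ^ 1 ∂μ = 0 := by
  have hm : memFH3' (fun _ : ℝ => (1 : ℝ)) := by
    refine ⟨by fun_prop, fun t _ j _ => ?_⟩
    simp only [iteratedDeriv_const]
    exact (lawH3_mom j).mul_const _
  have := h.stein _ hm
  simp only [steinH3', iteratedDeriv_const, deriv_const] at this
  have e : ∀ y : ℝ, 5 * y * 1 - (3 * y ^ 2 + 12) * 0 + 207 * y * (if (2 : ℕ) = 0 then 1 else 0)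
    + (351 * y ^ 2 - 1080) * (if (3 : ℕ) = 0 then 1 else 0)
    + (81 * y ^ 3 - 324 * y) * (if (4 : ℕ) = 0 then 1 else 0) = 5 * y ^ 1 := by
    intro y; simp
  rw [integral_congr_ae (ae_of_all _ e), integral_const_mul] at this
  linarith

lemma Good.m2 {μ : Measure ℝ} (h : Good μ) : ∫ y, y ^ 2 ∂μ = 6 := by
  have hm : memFH3' (fun y : ℝ => y ^ 1) := by
    refine ⟨by fun_prop, fun t _ j _ => ?_⟩
    rw [iter_pow1]
    rcases t with _ | _ | t
    · simpa [pow_succ] using lawH3_mom (j + 1)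
    · simpa using lawH3_mom j
    · simp
  have := h.stein _ hm
  have e : ∀ y : ℝ, steinH3' (fun y : ℝ => y ^ 1) y = 2 * y ^ 2 - 12 * y ^ 0 := by
    intro y
    simp only [steinH3', ← iteratedDeriv_one, iter_pow1]
    norm_num
    ring
  rw [integral_congr_ae (ae_of_all _ e), integral_sub ((h.mom 2 (by norm_num)).const_mul _)
    ((h.mom 0 (by norm_num)).const_mul _), integral_const_mul, integral_const_mul, h.m0] at this
  linarith

lemma Good.m3 {μ : Measure ℝ} (h : Good μ) : ∫ y, y ^ 3 ∂μ = 0 := by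
  have hm : memFH3' (fun y : ℝ => y ^ 2) := by
    refine ⟨by fun_prop, fun t _ j _ => ?_⟩
    rw [iter_pow2]
    rcases t with _ | _ | _ | t
    · simpa [pow_add] using lawH3_mom (j + 2)
    · refine ((lawH3_mom (j + 1)).const_mul 2).congr (ae_of_all _ fun y => ?_)
      simp; ring
    · simpa using (lawH3_mom j).mul_const 2
    · simp
  have := h.stein _ hm
  have e : ∀ y : ℝ, steinH3' (fun y : ℝ => y ^ 2) y = 390 * y ^ 1 - 1 * y ^ 3 := by
    intro y
    simp only [steinH3', ← iteratedDeriv_one, iter_pow2]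
    norm_num
    ring
  rw [integral_congr_ae (ae_of_all _ e), integral_sub ((h.mom 1 (by norm_num)).const_mul _)
    ((h.mom 3 (by norm_num)).const_mul _), integral_const_mul, integral_const_mul, h.m1] at this
  linarith

lemma GG_zero (μ : Measure ℝ) (k : ℕ) (θ : ℝ) : GG μ k θ 0 = (∫ y, y ^ k ∂μ) * Real.sin θ := by
  simp [GG, integral_mul_const]

lemma GG_neg (μ : Measure ℝ) (θ ξ : ℝ) : GG μ 0 θ ξ = - GG μ 0 (-θ) (-ξ) := by
  unfold GG
  rw [← integral_neg]
  congr 1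
  ext y
  rw [← mul_neg, ← Real.sin_neg]
  congr 2
  ring

lemma charFun_GG (μ : Measure ℝ) [IsProbabilityMeasure μ] (t : ℝ) :
    charFun μ t = (GG μ 0 (Real.pi / 2) t : ℂ) + (GG μ 0 0 t : ℂ) * Complex.I := by
  have h0 : Integrable (fun y : ℝ => y ^ 0) μ := by simp
  rw [charFun_apply_real]
  unfold GG
  rw [← integral_complex_ofReal, ← integral_complex_ofReal, ← integral_mul_const, ← integral_add]
  · congr 1
    ext y
    simp only [pow_zero, one_mul, Real.sin_add_pi_div_two, add_zero]
    rw [Complex.exp_mul_I]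
    norm_num
  · exact (GG_int h0 _ _).ofReal
  · exact ((GG_int h0 _ _).ofReal).mul_const _

lemma Good.eq {μ ν : Measure ℝ} (hμ : Good μ) (hν : Good ν) : μ = ν := by
  have key : ∀ θ T, 0 ≤ T → GG μ 0 θ T = GG ν 0 θ T := by
    intro θ T hT
    have d := fun (k : ℕ) (hk : k + 1 ≤ 3) (θ x : ℝ) =>
      (GG_deriv (hμ.mom k (by omega)) (hμ.mom (k + 1) hk) θ x).sub
        (GG_deriv (hν.mom k (by omega)) (hν.mom (k + 1) hk) θ x)
    have := aux_uniq (ψ := fun x => GG μ 0 θ x - GG ν 0 θ x)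
      (p := fun x => GG μ 1 (θ + Real.pi / 2) x - GG ν 1 (θ + Real.pi / 2) x)
      (u := fun x => GG μ 2 (θ + Real.pi / 2 + Real.pi / 2) x
        - GG ν 2 (θ + Real.pi / 2 + Real.pi / 2) x)
      (w := fun x => GG μ 3 (θ + Real.pi / 2 + Real.pi / 2 + Real.pi / 2) x
        - GG ν 3 (θ + Real.pi / 2 + Real.pi / 2 + Real.pi / 2) x)
      (d 0 (by norm_num) _) (d 1 (by norm_num) _) (d 2 (by norm_num) _)
      (by simp only [GG_zero, hμ.m0, hν.m0, sub_self])
      (by simp only [GG_zero, hμ.m1, hν.m1, sub_self])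
      (by simp only [GG_zero, hμ.m2, hν.m2, sub_self])
      (by simp only [GG_zero, hμ.m3, hν.m3, sub_self])
      (fun x => by linear_combination hμ.ode θ x - hν.ode θ x) T hT
    exact sub_eq_zero.1 this
  have key2 : ∀ θ T, GG μ 0 θ T = GG ν 0 θ T := by
    intro θ T
    rcases le_total 0 T with h | h
    · exact key θ T h
    · rw [GG_neg μ, GG_neg ν, key _ _ (by linarith)]
  have := hμ.prob
  have := hν.prob
  refine Measure.ext_of_charFun (funext fun t => ?_)
  rw [charFun_GG, charFun_GG, key2, key2]

lemma lawH3_good : Good lawH3 := ⟨lawH3_prob, fun k _ => lawH3_mom k, lawH3_stein⟩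


/-- Stein characterisation of `H₃(X) = X³ - 3X`, `X ∼ N(0,1)`, via the
operator `S₃'`. -/
theorem stein_characterisation_H3_low_order
    {Ω : Type*} [MeasurableSpace Ω] (ν : Measure Ω) [IsProbabilityMeasure ν]
    (W : Ω → ℝ) (hW : Measurable W)
    (hWmom : Integrable (fun ω => |W ω| ^ 3) ν) :
    Measure.map W ν = lawH3 ↔
      ∀ f : ℝ → ℝ, memFH3' f → ∫ ω, steinH3' f (W ω) ∂ν = 0 := by
  have hmap : ∀ f, memFH3' f → ∫ ω, steinH3' f (W ω) ∂ν = ∫ y, steinH3' f y ∂(Measure.map W ν) :=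
    fun f hf => (integral_map hW.aemeasurable (stein_cont hf.1).aestronglyMeasurable).symm
  constructor
  · intro h f hf
    rw [hmap f hf, h]
    exact lawH3_stein f hf
  · intro h
    refine Good.eq ⟨Measure.isProbabilityMeasure_map hW.aemeasurable, fun k hk => ?_, fun f hf => ?_⟩
      lawH3_good
    · rw [integrable_map_measure (by fun_prop) hW.aemeasurable]
      refine ((integrable_const (1 : ℝ)).add hWmom).mono
        (by fun_prop) (ae_of_all _ fun ω => ?_)
      simp only [Function.comp_apply, Pi.add_apply, norm_pow, Real.norm_eq_abs]
      have h0 := abs_nonneg (W ω)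
      have h3 : 0 ≤ |W ω| ^ 3 := by positivity
      rw [abs_of_nonneg (by positivity : 0 ≤ 1 + |W ω| ^ 3)]
      rcases le_total |W ω| 1 with h1 | h1
      · linarith [pow_le_one₀ h0 h1 (n := k)]
      · linarith [pow_le_pow_right₀ h1 hk]
    · rw [← hmap f hf]
      exact h f hf
end
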